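/- The space CF is aspherical: for every k ≥ 2 and every basepoint, the homotopy group π_k(CF) is trivial. -/

import Mathlib

/-- The set `CF_n ⊆ ℝ^n`: nondecreasing tuples with `t_{i+2} - t_i ≥ 1`. -/
def CFset (n : ℕ) : Set (Fin n → ℝ) :=
  {t | Monotone t ∧ ∀ (i : ℕ) (h : i + 2 < n), 1 ≤ t ⟨i + 2, h⟩ - t ⟨i, by omega⟩}

/-- `CF_n` as a topological space (subspace of `ℝ^n`). -/
abbrev CFn (n : ℕ) := ↥(CFset n)

/-- The disjoint union `⨿_{n ≥ 1} CF_n`. -/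
abbrev PreCF := (n : ℕ) × CFn (n + 1)

/-- Duplication of the `i`-th entry of a tuple. -/
def dup {n : ℕ} (t : Fin (n + 1) → ℝ) (i : Fin (n + 1)) : Fin (n + 2) → ℝ :=
  Fin.insertNth i.castSucc (t i) t

/-- The identification: a tuple is related to the result of duplicating one of its
entries, whenever the duplicated tuple still lies in the relevant `CF_{n+1}`. -/
def CFrel : PreCF → PreCF → Prop := fun x y =>
  ∃ (i : Fin (x.1 + 1)) (h : dup (x.2 : Fin (x.1 + 1) → ℝ) i ∈ CFset (x.1 + 2)),
    y = ⟨x.1 + 1, ⟨dup (x.2 : Fin (x.1 + 1) → ℝ) i, h⟩⟩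

/-- Belk's space `CF`: the quotient of `⨿ CF_n` by the identifications. -/
abbrev CF := Quot CFrel

/-- A basepoint of `CF`: the one-point configuration `(1)`. -/
def CFbase : CF :=
  Quot.mk CFrel ⟨0, ⟨fun _ => 1, ⟨monotone_const, fun i h => absurd h (by omega)⟩⟩⟩

open Topology Filter unitInterval

theorem lift_cocycle {A : Type*} [TopologicalSpace A] [SimplyConnectedSpace A]
    [LocallyPathConnectedSpace A] {Γ : Type*} [Group Γ] (U : A → Set A)
    (hU : ∀ a, IsOpen (U a)) (hmem : ∀ a, a ∈ U a) (θ : A → A → Γ) (hθ : ∀ a, θ a a = 1)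
    (coc : ∀ a, ∀ b ∈ U a, ∀ᶠ c in 𝓝 b, c ∈ U a → θ a c = θ b c * θ a b) (a₀ : A) :
    ∃ l : A → Γ, l a₀ = 1 ∧ ∀ a, ∀ᶠ b in 𝓝 a, l b = θ a b * l a := by
  let _ : TopologicalSpace Γ := ⊥
  have _ : DiscreteTopology Γ := ⟨rfl⟩
  let Z : FiberBundleCore A A Γ :=
    { baseSet := U
      isOpen_baseSet := hU
      indexAt := id
      mem_baseSet_at := hmem
      coordChange := fun a b x v => (θ b x)⁻¹ * θ a x * v
      coordChange_self := by intro a x _ v; simp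
      continuousOn_coordChange := by
        rintro a b ⟨x, v⟩ ⟨⟨hxa, hxb⟩, -⟩
        have hxa' : x ∈ U a := hxa
        have hxb' : x ∈ U b := hxb
        have h1 := (coc a x hxa').and (coc b x hxb')
        have h2 := h1.and (((hU a).eventually_mem hxa').and ((hU b).eventually_mem hxb'))
        have h3 : ∀ᶠ p in 𝓝 (x, v), (θ b p.1)⁻¹ * θ a p.1 * p.2 = (θ b x)⁻¹ * θ a x * p.2 := by
          have := (continuous_fst (X := A) (Y := Γ)).continuousAt (x := (x, v)) |>.eventually h2
          filter_upwards [this] with p hp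
          rw [hp.1.1 hp.2.1, hp.1.2 hp.2.2]
          group
        have h4 : ContinuousAt (fun p : A × Γ => (θ b x)⁻¹ * θ a x * p.2) (x, v) := by
          have : Continuous (fun g : Γ => (θ b x)⁻¹ * θ a x * g) := continuous_of_discreteTopology
          exact (this.comp continuous_snd).continuousAt
        exact (h4.congr_of_eventuallyEq h3).continuousWithinAt
      coordChange_comp := by intro i j k x _ v; group }
  have cov : IsCoveringMap (Bundle.TotalSpace.proj : Bundle.TotalSpace Γ Z.Fiber → A) :=
    FiberBundle.isCoveringMap
  obtain ⟨F, ⟨hF0, hF⟩, -⟩ := cov.existsUnique_continuousMap_lifts (ContinuousMap.id A) a₀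
    (⟨a₀, (1 : Γ)⟩ : Bundle.TotalSpace Γ Z.Fiber) rfl
  have hproj : ∀ a, (F a).proj = a := fun a => congrFun hF a
  let sn : Bundle.TotalSpace Γ Z.Fiber → Γ := fun p => p.snd
  refine ⟨fun a => sn (F a), ?_, ?_⟩
  · show sn (F a₀) = 1
    rw [hF0]
  · intro a
    have hc : ContinuousAt (fun b => (Z.localTrivAt a (F b)).2) a := by
      have h1 : ContinuousAt (Z.localTrivAt a) (F a) := by
        apply (Z.localTrivAt a).continuousAt
        rw [Z.mem_localTrivAt_source, hproj]
        exact hmem a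
      exact continuous_snd.continuousAt.comp (ContinuousAt.comp h1 F.continuous.continuousAt)
    have h2 : ∀ᶠ b in 𝓝 a, (Z.localTrivAt a (F b)).2 = (Z.localTrivAt a (F a)).2 :=
      hc.eventually (show ∀ᶠ y in 𝓝 _, y = _ from (by rw [nhds_discrete]; exact rfl))
    have h3 : ∀ b, (Z.localTrivAt a (F b)).2 = (θ a b)⁻¹ * sn (F b) := by
      intro b
      show (θ a (F b).proj)⁻¹ * θ (F b).proj (F b).proj * sn (F b) = _
      rw [hθ, hproj]; simp
    filter_upwards [h2] with b hb
    rw [h3, h3, hθ] at hb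
    show sn (F b) = θ a b * sn (F a)
    have : sn (F b) = θ a b * ((θ a b)⁻¹ * sn (F b)) := by group
    rw [this, hb]; simp

/-- coordinatewise squeeze of the cube -/
noncomputable def cubeSq (k : ℕ) : C(I × (Fin k → I), Fin k → I) where
  toFun p := fun i => Set.projIcc (0:ℝ) 1 zero_le_one ((1 + (p.1:ℝ)) * (p.2 i : ℝ) - (p.1:ℝ) / 2)
  continuous_toFun := by
    refine continuous_pi fun i => continuous_projIcc.comp ?_
    fun_prop

lemma cubeSq_boundary {k : ℕ} (s : I) (y : Fin k → I) (hy : y ∈ Cube.boundary (Fin k)) :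
    cubeSq k (s, y) ∈ Cube.boundary (Fin k) := by
  obtain ⟨i, hi⟩ := hy
  refine ⟨i, ?_⟩
  have hs := s.2
  rcases hi with hi | hi
  · left
    show Set.projIcc (0:ℝ) 1 zero_le_one _ = _
    apply Set.projIcc_of_le_left
    simp [hi]; linarith [hs.1]
  · right
    show Set.projIcc (0:ℝ) 1 zero_le_one _ = _
    apply Set.projIcc_of_right_le
    simp [hi]; linarith [hs.1]

/-- collar function -/
noncomputable def collar (k : ℕ) : C(Fin k → I, I) where
  toFun y := Set.projIcc (0:ℝ) 1 zero_le_one (∏ i, (min 1 (4 * min (y i : ℝ) (1 - y i))))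
  continuous_toFun := by
    refine continuous_projIcc.comp ?_
    fun_prop

lemma collar_boundary {k : ℕ} (y : Fin k → I) (hy : y ∈ Cube.boundary (Fin k)) :
    collar k y = 0 := by
  obtain ⟨i, hi⟩ := hy
  show Set.projIcc (0:ℝ) 1 zero_le_one _ = _
  apply Set.projIcc_of_le_left
  apply le_of_eq
  apply Finset.prod_eq_zero (Finset.mem_univ i)
  rcases hi with hi | hi <;> simp [hi]

lemma collar_or {k : ℕ} (y : Fin k → I) :
    collar k y = 1 ∨ cubeSq k (1, y) ∈ Cube.boundary (Fin k) := by
  by_cases h : ∀ i, (1/4 : ℝ) ≤ y i ∧ (y i : ℝ) ≤ 3/4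
  · left
    show Set.projIcc (0:ℝ) 1 zero_le_one _ = _
    apply Set.projIcc_of_right_le
    apply le_of_eq
    symm
    apply Finset.prod_eq_one
    intro i _
    apply min_eq_left
    have := h i
    rcases min_choice (y i : ℝ) (1 - y i) with h' | h' <;> rw [h'] <;> linarith
  · right
    push Not at h
    obtain ⟨i, hi⟩ := h
    refine ⟨i, ?_⟩
    by_cases h1 : (1/4 : ℝ) ≤ y i
    · right
      show Set.projIcc (0:ℝ) 1 zero_le_one _ = _
      apply Set.projIcc_of_right_le
      have := hi h1
      simp; linarith
    · left
      show Set.projIcc (0:ℝ) 1 zero_le_one _ = _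
      apply Set.projIcc_of_le_left
      push Not at h1
      simp; linarith

theorem genLoop_null {W : Type*} [TopologicalSpace W] [ContractibleSpace W] {k : ℕ}
    (F : C(Fin k → I, W)) (w : W) (hF : ∀ y ∈ Cube.boundary (Fin k), F y = w) :
    F.HomotopicRel (ContinuousMap.const _ w) (Cube.boundary (Fin k)) := by
  obtain ⟨w1, ⟨h⟩⟩ := (contractible_iff_id_nullhomotopic W).1 inferInstance
  have h0 : ∀ x, h (0, x) = x := fun x => h.apply_zero x
  have h1 : ∀ x, h (1, x) = w1 := fun x => h.apply_one x
  have sq0 : ∀ y, cubeSq k (0, y) = y := by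
    intro y; funext i
    show Set.projIcc (0:ℝ) 1 zero_le_one _ = _
    simp
  have A : F.HomotopicRel (F.comp ((cubeSq k).comp (.prodMk (.const _ 1) (.id _))))
      (Cube.boundary (Fin k)) := by
    refine ⟨⟨⟨F.comp (cubeSq k), ?_, ?_⟩, ?_⟩⟩
    · intro y; simp [sq0]
    · intro y; simp
    · intro t y hy
      simp only [ContinuousMap.toFun_eq_coe, ContinuousMap.comp_apply]
      rw [hF _ hy]; exact hF _ (cubeSq_boundary t y hy)
  have B : (F.comp ((cubeSq k).comp (.prodMk (.const _ 1) (.id _)))).HomotopicRel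
      (h.toContinuousMap.comp ((collar k).prodMk (.const _ w))) (Cube.boundary (Fin k)) := by
    refine ⟨⟨⟨⟨fun p => h (p.1 * collar k p.2, F (cubeSq k (1, p.2))), ?_⟩, ?_, ?_⟩, ?_⟩⟩
    · fun_prop
    · intro y; simp [h0]
    · intro y
      rcases collar_or y with hy | hy
      · simp [hy, h1]
      · simp [hF _ hy]
    · intro t y hy
      simp [collar_boundary y hy, h0]
  have C : (h.toContinuousMap.comp ((collar k).prodMk (.const _ w))).HomotopicRel
      (ContinuousMap.const _ w) (Cube.boundary (Fin k)) := by
    refine ⟨⟨⟨⟨fun p => h (σ p.1 * collar k p.2, w), ?_⟩, ?_, ?_⟩, ?_⟩⟩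
    · fun_prop
    · intro y; simp
    · intro y; simp [h0]
    · intro t y hy
      simp [collar_boundary y hy]
  exact (A.trans B).trans C

def IsCfg (τ : ℤ → ℝ) : Prop := StrictMono τ ∧ ∀ i, 1 ≤ τ (i + 2) - τ i

def SepCfg (ρ : ℝ) (τ : ℤ → ℝ) : Prop := 0 < ρ ∧ ρ ≤ 1 / 16 ∧ ∀ i, 4 * ρ ≤ τ (i + 1) - τ i

def Match (ρ : ℝ) (τ τ' : ℤ → ℝ) (K : ℤ → ℤ) : Prop :=
  (∀ i, K i < K (i + 1)) ∧ ∀ i l, K i ≤ l → l < K (i + 1) → |τ' l - τ i| < ρ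

lemma Match.mono {ρ ρ' : ℝ} {τ τ' : ℤ → ℝ} {K : ℤ → ℤ} (h : Match ρ τ τ' K) (hr : ρ ≤ ρ') :
    Match ρ' τ τ' K := ⟨h.1, fun i l h1 h2 => (h.2 i l h1 h2).trans_le hr⟩

lemma blocks {K : ℤ → ℤ} (hK : ∀ i, K i < K (i + 1)) (l : ℤ) : ∃ i, K i ≤ l ∧ l < K (i + 1) := by
  have hm : StrictMono K := strictMono_int_of_lt_succ hK
  have up : ∀ n : ℕ, K 0 + n ≤ K n := by
    intro n
    induction n with
    | zero => simp
    | succ n ih => have := hK n; push_cast; linarith [Int.add_one_le_of_lt this]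
  have dn : ∀ n : ℕ, K (-n) ≤ K 0 - n := by
    intro n
    induction n with
    | zero => simp
    | succ n ih =>
      have := hK (-(n:ℤ) - 1)
      have e : -(n:ℤ) - 1 + 1 = -n := by ring
      rw [e] at this
      have e2 : (-((n + 1 : ℕ) : ℤ)) = -(n:ℤ) - 1 := by push_cast; ring
      rw [e2]; push_cast; linarith [Int.add_one_le_of_lt this]
  obtain ⟨i, hi, hmax⟩ := Int.exists_greatest_of_bdd (P := fun i => K i ≤ l)
    ⟨(l - K 0).natAbs + 1, fun z hz => by
      by_contra hlt
      push Not at hlt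
      have h1 := up ((l - K 0).natAbs + 1)
      have h2 := hm hlt
      have h3 : l - K 0 ≤ (l - K 0).natAbs := Int.le_natAbs
      generalize (l - K 0).natAbs = m at *
      push_cast at h1
      omega⟩
    ⟨-((l - K 0).natAbs : ℤ), by
      have h1 := dn (l - K 0).natAbs
      omega⟩
  refine ⟨i, hi, ?_⟩
  by_contra h
  have := hmax (i + 1) (not_lt.1 h)
  omega

lemma SepCfg.far {ρ : ℝ} {τ : ℤ → ℝ} (h : SepCfg ρ τ) {i j : ℤ} (hij : i < j) :
    4 * ρ ≤ τ j - τ i := by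
  have hm : StrictMono τ := strictMono_int_of_lt_succ fun i => by
    have := h.2.2 i; have := h.1; linarith
  have h1 := hm.monotone (show i + 1 ≤ j by omega)
  linarith [h.2.2 i]

lemma SepCfg.uniq {ρ : ℝ} {τ : ℤ → ℝ} (h : SepCfg ρ τ) {i j : ℤ} {y : ℝ}
    (hi : |y - τ i| < 2 * ρ) (hj : |y - τ j| < 2 * ρ) : i = j := by
  rw [abs_lt] at hi hj
  rcases lt_trichotomy i j with hl | hl | hl
  · linarith [h.far hl]
  · exact hl
  · linarith [h.far hl]

lemma match_unique {ρ : ℝ} {τ τ' : ℤ → ℝ} {K L : ℤ → ℤ} (hs : SepCfg ρ τ)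
    (hK : Match (2 * ρ) τ τ' K) (hL : Match (2 * ρ) τ τ' L) : K = L := by
  have key : ∀ {K L : ℤ → ℤ}, Match (2 * ρ) τ τ' K → Match (2 * ρ) τ τ' L → ∀ i, L i ≤ K i := by
    intro K L hK hL i
    obtain ⟨j, hj1, hj2⟩ := blocks hL.1 (K i)
    have := hs.uniq (hK.2 i (K i) le_rfl (hK.1 i)) (hL.2 j _ hj1 hj2)
    rwa [this] at hj1 ⊢
  funext i
  exact le_antisymm (key hL hK i) (key hK hL i)

lemma match_le2 {r : ℝ} {τ τ' : ℤ → ℝ} {K : ℤ → ℤ} (hr : r ≤ 1 / 2) (h : Match r τ τ' K)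
    (hτ' : IsCfg τ') (i : ℤ) : K (i + 1) ≤ K i + 2 := by
  by_contra hlt
  push Not at hlt
  have h1 := h.2 i (K i) le_rfl (h.1 i)
  have h2 := h.2 i (K i + 2) (by omega) hlt
  have h3 := hτ'.2 (K i)
  rw [abs_lt] at h1 h2
  linarith

lemma match_comp {r r' R : ℝ} {τ τ' τ'' : ℤ → ℝ} {K K' : ℤ → ℤ} (h : Match r τ τ' K)
    (h' : Match r' τ' τ'' K') (hR : r + r' ≤ R) : Match R τ τ'' (K' ∘ K) := by
  have hm' : StrictMono K' := strictMono_int_of_lt_succ h'.1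
  refine ⟨fun i => hm' (h.1 i), ?_⟩
  intro i l h1 h2
  obtain ⟨j, hj1, hj2⟩ := blocks h'.1 l
  have a1 : K i ≤ j := by
    have : K' (K i) < K' (j + 1) := lt_of_le_of_lt h1 hj2
    have := hm'.lt_iff_lt.1 this
    omega
  have a2 : j < K (i + 1) := hm'.lt_iff_lt.1 (lt_of_le_of_lt hj1 h2)
  have b1 := h'.2 j l hj1 hj2
  have b2 := h.2 i j a1 a2
  rw [abs_lt] at *
  constructor <;> linarith

/-! ### piecewise linear maps -/

noncomputable def plFun (K : ℤ → ℤ) (u : ℝ) : ℝ :=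
  K ⌊u⌋ + ((K (⌊u⌋ + 1) : ℝ) - K ⌊u⌋) * Int.fract u

lemma plFun_eq (K : ℤ → ℤ) (i : ℤ) (u : ℝ) (h1 : (i:ℝ) ≤ u) (h2 : u ≤ i + 1) :
    plFun K u = K i + ((K (i + 1) : ℝ) - K i) * (u - i) := by
  rcases h2.lt_or_eq with h | h
  · have : ⌊u⌋ = i := Int.floor_eq_iff.2 ⟨h1, h⟩
    unfold plFun Int.fract
    rw [this]
  · have : ⌊u⌋ = i + 1 := by rw [Int.floor_eq_iff]; push_cast; constructor <;> linarith
    unfold plFun Int.fract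
    rw [this, h]; push_cast; ring

lemma plFun_strictMono {K : ℤ → ℤ} (hK : ∀ i, K i < K (i + 1)) : StrictMono (plFun K) := by
  intro u v huv
  have hm : StrictMono K := strictMono_int_of_lt_succ hK
  have fu := Int.floor_le u
  have fu' := Int.lt_floor_add_one u
  have fv := Int.floor_le v
  have fv' := Int.lt_floor_add_one v
  have pu : (0:ℝ) < K (⌊u⌋ + 1) - K ⌊u⌋ := by have := hK ⌊u⌋; rw [sub_pos]; exact_mod_cast this
  have pv : (0:ℝ) < K (⌊v⌋ + 1) - K ⌊v⌋ := by have := hK ⌊v⌋; rw [sub_pos]; exact_mod_cast this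
  rw [plFun_eq K ⌊u⌋ u fu fu'.le, plFun_eq K ⌊v⌋ v fv fv'.le]
  rcases (Int.floor_mono huv.le).lt_or_eq with h | h
  · have h1 : ((K (⌊u⌋ + 1) : ℤ) : ℝ) ≤ K ⌊v⌋ := by
      exact_mod_cast hm.monotone (show ⌊u⌋ + 1 ≤ ⌊v⌋ by omega)
    nlinarith
  · rw [← h] at *
    nlinarith

lemma plFun_surj {K : ℤ → ℤ} (hK : ∀ i, K i < K (i + 1)) : Function.Surjective (plFun K) := by
  intro v
  obtain ⟨i, h1, h2⟩ := blocks hK ⌊v⌋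
  have pu : (0:ℝ) < K (i + 1) - K i := by have := hK i; rw [sub_pos]; exact_mod_cast this
  have a1 : (K i : ℝ) ≤ v := by
    have : (K i : ℝ) ≤ ⌊v⌋ := by exact_mod_cast h1
    linarith [Int.floor_le v]
  have a2 : v ≤ (K (i + 1) : ℝ) := by
    have : (⌊v⌋ : ℝ) + 1 ≤ K (i + 1) := by exact_mod_cast h2
    linarith [Int.lt_floor_add_one v]
  refine ⟨i + (v - K i) / (K (i + 1) - K i), ?_⟩
  rw [plFun_eq K i]
  · field_simp; ring
  · have : 0 ≤ (v - K i) / (K (i + 1) - K i) := div_nonneg (by linarith) pu.le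
    linarith
  · have : (v - K i) / (K (i + 1) - K i) ≤ 1 := by rw [div_le_one pu]; linarith
    linarith

noncomputable def pl (K : ℤ → ℤ) (hK : ∀ i, K i < K (i + 1)) : ℝ ≃o ℝ :=
  StrictMono.orderIsoOfSurjective (plFun K) (plFun_strictMono hK) (plFun_surj hK)

@[simp] lemma pl_apply (K : ℤ → ℤ) (hK : ∀ i, K i < K (i + 1)) (u : ℝ) : pl K hK u = plFun K u := rfl

lemma pl_comp {K K' : ℤ → ℤ} (hK : ∀ i, K i < K (i + 1)) (hK' : ∀ i, K' i < K' (i + 1))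
    (h2 : ∀ i, K' (K (i + 1)) ≤ K' (K i) + 2) (hc : ∀ i, (K' ∘ K) i < (K' ∘ K) (i + 1)) :
    pl (K' ∘ K) hc = pl K' hK' * pl K hK := by
  have hm' : StrictMono K' := strictMono_int_of_lt_succ hK'
  ext u
  show plFun (K' ∘ K) u = plFun K' (plFun K u)
  set i := ⌊u⌋ with hi
  have f1 := Int.floor_le u
  have f2 := Int.lt_floor_add_one u
  rw [← hi] at f1 f2
  rw [plFun_eq _ i u f1 f2.le, plFun_eq K i u f1 f2.le]
  have e1 := hK i
  have e2 := h2 i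
  have e3 : K (i + 1) = K i + 1 ∨ K (i + 1) = K i + 2 := by
    by_contra hne
    have q : K i + 3 ≤ K (i + 1) := by omega
    have q1 := hm'.monotone q
    have q2 := hK' (K i)
    have q3 := hK' (K i + 1)
    have q4 := hK' (K i + 2)
    have r1 : K i + 1 + 1 = K i + 2 := by ring
    have r2 : K i + 2 + 1 = K i + 3 := by ring
    rw [r1] at q3; rw [r2] at q4
    omega
  rcases e3 with e | e
  · rw [plFun_eq K' (K i)]
    · simp only [Function.comp, e]; push_cast; ring
    · rw [e]; push_cast; nlinarith
    · rw [e]; push_cast; nlinarith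
  · have q2 := hK' (K i)
    have q3 := hK' (K i + 1)
    have r1 : K i + 1 + 1 = K i + 2 := by ring
    rw [r1] at q3
    rw [e] at e2
    have s1 : K' (K i + 1) = K' (K i) + 1 := by omega
    have s2 : K' (K i + 2) = K' (K i) + 2 := by omega
    by_cases hh : u ≤ i + 1 / 2
    · rw [plFun_eq K' (K i)]
      · simp only [Function.comp, e, s1, s2]; push_cast; ring
      · rw [e]; push_cast; nlinarith
      · rw [e]; push_cast; nlinarith
    · push Not at hh
      rw [plFun_eq K' (K i + 1)]
      · rw [r1]; simp only [Function.comp, e, s1, s2]; push_cast; ring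
      · rw [e]; push_cast; nlinarith
      · rw [e]; push_cast; nlinarith

/-! ### dyadics -/

def IsDy (k : ℕ) (v : ℝ) : Prop := ∃ c : ℤ, v = c / 2 ^ k

noncomputable def dep (v : ℝ) : ℕ := sInf {k | IsDy k v}

lemma dep_le {k : ℕ} {v : ℝ} (h : IsDy k v) : dep v ≤ k := Nat.sInf_le h

lemma dy_dep {k : ℕ} {v : ℝ} (h : IsDy k v) : IsDy (dep v) v :=
  Nat.sInf_mem (s := {k | IsDy k v}) ⟨k, h⟩

lemma IsDy.mono {k l : ℕ} {v : ℝ} (h : IsDy k v) (hkl : k ≤ l) : IsDy l v := by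
  obtain ⟨c, rfl⟩ := h
  obtain ⟨m, rfl⟩ := Nat.exists_eq_add_of_le hkl
  exact ⟨c * 2 ^ m, by push_cast; rw [pow_add]; field_simp⟩

lemma dep_congr {v w : ℝ} (h : ∀ k, IsDy k v ↔ IsDy k w) : dep v = dep w := by
  unfold dep; congr 1; ext k; exact h k

lemma isDy_add_int (k : ℕ) (v : ℝ) (z : ℤ) (h : IsDy k v) : IsDy k (v + z) := by
  obtain ⟨c, rfl⟩ := h
  exact ⟨c + z * 2 ^ k, by push_cast; field_simp⟩

lemma dep_add_int (v : ℝ) (z : ℤ) : dep (v + z) = dep v := by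
  apply dep_congr
  intro k
  refine ⟨fun h => ?_, isDy_add_int k v z⟩
  have := isDy_add_int k _ (-z) h
  push_cast at this
  simpa using this

lemma isDy_two (k : ℕ) (v : ℝ) : IsDy k (2 * v) ↔ IsDy (k + 1) v := by
  constructor
  · rintro ⟨c, hc⟩
    refine ⟨c, ?_⟩
    rw [pow_succ]; field_simp; field_simp at hc; linarith
  · rintro ⟨c, hc⟩
    refine ⟨c, ?_⟩
    rw [hc, pow_succ]; field_simp

lemma dep_pos {k : ℕ} {v : ℝ} (h : IsDy k v) (hv : (⌊v⌋ : ℝ) ≠ v) : 1 ≤ dep v := by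
  by_contra hlt
  have h0 : dep v = 0 := by omega
  have := dy_dep h
  rw [h0] at this
  obtain ⟨c, hc⟩ := this
  apply hv
  simp at hc
  rw [hc]; simp

lemma dep_two {k : ℕ} {v : ℝ} (h : IsDy k v) (hv : (⌊v⌋ : ℝ) ≠ v) : dep (2 * v) + 1 = dep v := by
  have h1 := dep_pos h hv
  have h2 := dy_dep h
  obtain ⟨m, hm⟩ := Nat.exists_eq_add_of_le h1
  rw [hm, add_comm, ← isDy_two] at h2
  have h3 := dep_le h2
  have h4 := dep_le ((isDy_two _ v).1 (dy_dep h2))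
  omega

/-- A dyadic of depth exactly `k ≥ 1` has an odd numerator. -/
lemma dep_odd {m : ℕ} {v : ℝ} (h : IsDy m v) (hp : 1 ≤ dep v) :
    ∃ c : ℤ, v = (2 * c + 1) / 2 ^ (dep v) := by
  obtain ⟨b, hb⟩ := dy_dep h
  rcases Int.even_or_odd' b with ⟨c, hc | hc⟩
  · exfalso
    obtain ⟨l, hl⟩ := Nat.exists_eq_add_of_le hp
    have : IsDy l v := ⟨c, by
      rw [hb, hl, hc, add_comm, pow_succ]; push_cast; field_simp⟩
    have := dep_le this
    omega
  · exact ⟨c, by rw [hc] at hb; push_cast at hb; exact hb⟩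

/-! ### the gap function -/

noncomputable def rr (τ : ℤ → ℝ) (i : ℤ) : ℝ := min 1 (min (τ (i + 1) - τ i) (τ i - τ (i - 1)))

open Classical in
noncomputable def Gf (τ : ℤ → ℝ) (v : ℝ) : ℝ :=
  if (⌊v⌋ : ℝ) = v then τ ⌊v⌋ - τ (⌊v⌋ - 1) else rr τ ⌊v⌋ - dep v

lemma Gf_int (τ : ℤ → ℝ) (i : ℤ) : Gf τ i = τ i - τ (i - 1) := by
  simp [Gf]

lemma Gf_nonint (τ : ℤ → ℝ) {v : ℝ} (h : (⌊v⌋ : ℝ) ≠ v) : Gf τ v = rr τ ⌊v⌋ - dep v := by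
  simp [Gf, h]

lemma min_close {a b a' b' c : ℝ} (hc : 0 ≤ c) (h1 : |a - a'| ≤ c) (h2 : |b - b'| ≤ c) :
    |min 1 (min a b) - min 1 (min a' b')| ≤ c := by
  have e1 := abs_min_sub_min_le_max 1 (min a b) 1 (min a' b')
  have e2 := abs_min_sub_min_le_max a b a' b'
  refine e1.trans (max_le (by simpa using hc) (e2.trans (max_le h1 h2)))

lemma Gf_close {r : ℝ} {τ τ' : ℤ → ℝ} {K : ℤ → ℤ} (hτ' : IsCfg τ')
    (hr : r ≤ 1 / 2) (hM : Match r τ τ' K) {v : ℝ} {k : ℕ} (hv : IsDy k v) :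
    |Gf τ' (plFun K v) - Gf τ v| ≤ 4 * r := by
  have hl2 := match_le2 hr hM hτ'
  have inb : ∀ i, |τ' (K i) - τ i| < r := fun i => hM.2 i (K i) le_rfl (hM.1 i)
  have inb' : ∀ i, |τ' (K i - 1) - τ (i - 1)| < r := fun i => hM.2 (i - 1) (K i - 1) (by
    have := hM.1 (i - 1); rw [sub_add_cancel] at this; omega) (by
    rw [sub_add_cancel]; omega)
  have hr0 : 0 < r := lt_of_le_of_lt (abs_nonneg _) (inb 0)
  by_cases hintg : (⌊v⌋ : ℝ) = v
  · rw [← hintg]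
    have : plFun K (⌊v⌋ : ℝ) = (K ⌊v⌋ : ℤ) := by
      rw [plFun_eq K ⌊v⌋ _ le_rfl (by linarith)]; simp
    rw [this, Gf_int, Gf_int]
    have h1 := inb ⌊v⌋
    have h2 := inb' ⌊v⌋
    rw [abs_lt] at h1 h2
    rw [abs_le]; constructor <;> linarith
  · rw [Gf_nonint τ hintg]
    set i := ⌊v⌋ with hi
    have f1 : (i : ℝ) < v := lt_of_le_of_ne (Int.floor_le v) hintg
    have f2 : v < i + 1 := Int.lt_floor_add_one v
    rw [plFun_eq K i v f1.le f2.le]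
    have e1 := hM.1 i
    have e2 := hl2 i
    have b0 := inb i
    have b1 := inb (i + 1)
    have b2 := inb' i
    rw [abs_lt] at b0 b1 b2
    rcases (show K (i + 1) = K i + 1 ∨ K (i + 1) = K i + 2 by omega) with e | e
    · have ew : (K i : ℝ) + ((K (i + 1) : ℝ) - K i) * (v - i) = v + ((K i - i : ℤ) : ℝ) := by
        rw [e]; push_cast; ring
      rw [ew]
      have fl : ⌊v + ((K i - i : ℤ) : ℝ)⌋ = K i := by
        rw [Int.floor_add_intCast]; omega
      rw [Gf_nonint, fl, dep_add_int]
      · have : |rr τ' (K i) - rr τ i| ≤ 4 * r := by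
          apply min_close (by linarith)
          · rw [← e, abs_le]; constructor <;> linarith
          · rw [abs_le]; constructor <;> linarith
        rw [abs_le] at *
        constructor <;> linarith
      · rw [fl]; push_cast; intro hh; apply hintg; linarith
    · have ew : (K i : ℝ) + ((K (i + 1) : ℝ) - K i) * (v - i) = 2 * v + ((K i - 2 * i : ℤ) : ℝ) := by
        rw [e]; push_cast; ring
      rw [ew]
      have c1 := hM.2 i (K i + 1) (by omega) (by omega)
      rw [abs_lt] at c1
      have v1 := hτ'.2 (K i)
      have v2 := hτ'.2 (K i - 1)
      rw [show K i - 1 + 2 = K i + 1 by ring] at v2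
      rw [e] at b1
      have pq : τ' (K i) < τ' (K i + 1) := hτ'.1 (by omega)
      have rle : rr τ i ≤ 1 := min_le_left _ _
      have rge : 1 - 2 * r ≤ rr τ i := le_min (by linarith) (le_min (by linarith) (by linarith))
      have dd := dep_two hv hintg
      have dd' : (dep (2 * v) : ℝ) + 1 = dep v := by exact_mod_cast dd
      have mono' := hτ'.1
      have nn : ∀ l, 0 ≤ rr τ' l := fun l => le_min zero_le_one
        (le_min (sub_nonneg.2 (mono'.monotone (by omega))) (sub_nonneg.2 (mono'.monotone (by omega))))
      rcases lt_trichotomy v (i + 1 / 2) with hh | hh | hh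
      · have fl : ⌊2 * v + ((K i - 2 * i : ℤ) : ℝ)⌋ = K i := by
          rw [Int.floor_eq_iff]; push_cast; constructor <;> linarith
        rw [Gf_nonint, fl, dep_add_int]
        · have u1 : rr τ' (K i) ≤ τ' (K i + 1) - τ' (K i) := (min_le_right _ _).trans (min_le_left _ _)
          have u2 := nn (K i)
          rw [abs_le]; constructor <;> linarith
        · rw [fl]; push_cast; intro hx; linarith
      · have : 2 * v + ((K i - 2 * i : ℤ) : ℝ) = ((K i + 1 : ℤ) : ℝ) := by
          rw [hh]; push_cast; ring
        rw [this, Gf_int, add_sub_cancel_right]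
        have d0 : dep (2 * v) = 0 := by
          have : IsDy 0 (2 * v) := ⟨2 * i + 1, by rw [hh]; push_cast; ring⟩
          have := dep_le this
          omega
        rw [d0] at dd'
        push_cast at dd'
        rw [abs_le]; constructor <;> linarith
      · have fl : ⌊2 * v + ((K i - 2 * i : ℤ) : ℝ)⌋ = K i + 1 := by
          rw [Int.floor_eq_iff]; push_cast; constructor <;> linarith
        rw [Gf_nonint, fl, dep_add_int]
        · have u1 : rr τ' (K i + 1) ≤ τ' (K i + 1) - τ' (K i + 1 - 1) :=
            (min_le_right _ _).trans (min_le_right _ _)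
          rw [add_sub_cancel_right] at u1
          have u2 := nn (K i + 1)
          rw [abs_le]; constructor <;> linarith
        · rw [fl]; push_cast; intro hx; linarith

def SD (N : ℕ) (lam : ℝ ≃o ℝ) : Prop :=
  ∃ κ : ℕ, ∀ c : ℤ, ∃ a : ℤ, ∃ l : ℕ, l ≤ N ∧ ∀ φ : ℝ, 0 ≤ φ → φ ≤ 1 →
    lam ((a + φ) / 2 ^ l) = (c + φ) / 2 ^ κ

lemma SD.mono {N N' : ℕ} {lam : ℝ ≃o ℝ} (h : SD N lam) (hN : N ≤ N') : SD N' lam := by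
  obtain ⟨κ, h⟩ := h
  refine ⟨κ, fun c => ?_⟩
  obtain ⟨a, l, hl, h⟩ := h c
  exact ⟨a, l, hl.trans hN, h⟩

lemma SD_one : SD 0 1 := ⟨0, fun c => ⟨c, 0, le_rfl, fun φ _ _ => by simp⟩⟩

lemma SD_pl {N : ℕ} {lam : ℝ ≃o ℝ} {K : ℤ → ℤ} (hK : ∀ i, K i < K (i + 1))
    (h2 : ∀ i, K (i + 1) ≤ K i + 2) (h : SD N lam) : SD (N + 1) (pl K hK * lam) := by
  obtain ⟨κ, h⟩ := h
  refine ⟨κ, fun c => ?_⟩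
  have hp : (0:ℤ) < 2 ^ κ := by positivity
  have hpr : (0:ℝ) < 2 ^ κ := by positivity
  obtain ⟨i, hi1, hi2⟩ := blocks hK (c / 2 ^ κ)
  have q1 : K i * 2 ^ κ ≤ c := by
    have := (Int.le_ediv_iff_mul_le hp).1 hi1; exact this
  have q2 : c + 1 ≤ K (i + 1) * 2 ^ κ := by
    have := (Int.ediv_lt_iff_lt_mul hp).1 hi2; omega
  have r1 : (K i : ℝ) * 2 ^ κ ≤ c := by exact_mod_cast q1
  have r2 : (c : ℝ) + 1 ≤ K (i + 1) * 2 ^ κ := by exact_mod_cast q2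
  have hk := hK i
  have hk2 := h2 i
  -- the preimage
  have key : ∀ φ : ℝ, 0 ≤ φ → φ ≤ 1 → ∀ u : ℝ,
      (K i : ℝ) + ((K (i + 1) : ℝ) - K i) * (u - i) = (c + φ) / 2 ^ κ →
      plFun K u = (c + φ) / 2 ^ κ := by
    intro φ h0 h1 u hu
    have pd : (0:ℝ) < K (i + 1) - K i := by rw [sub_pos]; exact_mod_cast hk
    have b1 : (K i : ℝ) ≤ (c + φ) / 2 ^ κ := by rw [le_div_iff₀ hpr]; linarith
    have b2 : (c + φ) / 2 ^ κ ≤ K (i + 1) := by rw [div_le_iff₀ hpr]; linarith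
    rw [plFun_eq K i u, hu]
    · by_contra hlt; push Not at hlt; nlinarith
    · by_contra hlt; push Not at hlt; nlinarith
  rcases (show K (i + 1) = K i + 1 ∨ K (i + 1) = K i + 2 by omega) with e | e
  · obtain ⟨a, l, hl, hh⟩ := h (c + (i - K i) * 2 ^ κ)
    refine ⟨a, l, by omega, fun φ h0 h1 => ?_⟩
    show plFun K (lam _) = _
    apply key φ h0 h1
    rw [hh φ h0 h1, e]; push_cast; field_simp; ring
  · obtain ⟨m, hm⟩ := Int.even_or_odd' ((2 * i - K i) * 2 ^ κ + c)
    obtain ⟨a, l, hl, hh⟩ := h m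
    rcases hm with hm | hm
    · refine ⟨2 * a, l + 1, by omega, fun φ h0 h1 => ?_⟩
      show plFun K (lam _) = _
      apply key φ h0 h1
      have : ((2 * a : ℤ) + φ) / 2 ^ (l + 1) = (a + φ / 2) / 2 ^ l := by
        rw [pow_succ]; push_cast; field_simp
      rw [this, hh _ (by linarith) (by linarith), e]
      have hm' : (2 * (i:ℝ) - K i) * 2 ^ κ + c = 2 * m := by exact_mod_cast hm
      push_cast; field_simp; linarith
    · refine ⟨2 * a + 1, l + 1, by omega, fun φ h0 h1 => ?_⟩
      show plFun K (lam _) = _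
      apply key φ h0 h1
      have : ((2 * a + 1 : ℤ) + φ) / 2 ^ (l + 1) = (a + (1 + φ) / 2) / 2 ^ l := by
        rw [pow_succ]; push_cast; field_simp; ring
      rw [this, hh _ (by linarith) (by linarith), e]
      have hm' : (2 * (i:ℝ) - K i) * 2 ^ κ + c = 2 * m + 1 := by exact_mod_cast hm
      push_cast; field_simp; linarith

lemma SD_pl' {N : ℕ} {lam : ℝ ≃o ℝ} {K : ℤ → ℤ} (hK : ∀ i, K i < K (i + 1))
    (h2 : ∀ i, K (i + 1) ≤ K i + 2) (h : SD N (pl K hK * lam)) : SD (N + 1) lam := by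
  obtain ⟨κ, h⟩ := h
  refine ⟨κ + 1, fun c => ?_⟩
  have hp : (0:ℤ) < 2 ^ (κ + 1) := by positivity
  have hpr : (0:ℝ) < 2 ^ (κ + 1) := by positivity
  obtain ⟨i, hi⟩ : ∃ i, i = c / 2 ^ (κ + 1) := ⟨_, rfl⟩
  have q1 : i * 2 ^ (κ + 1) ≤ c := (Int.le_ediv_iff_mul_le hp).1 hi.le
  have q2 : c + 1 ≤ (i + 1) * 2 ^ (κ + 1) := by
    have := (Int.ediv_lt_iff_lt_mul hp).1 (show c / 2 ^ (κ + 1) < i + 1 by omega); omega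
  have r1 : (i : ℝ) * 2 ^ (κ + 1) ≤ c := by exact_mod_cast q1
  have r2 : (c : ℝ) + 1 ≤ (i + 1) * 2 ^ (κ + 1) := by exact_mod_cast q2
  have hk := hK i
  have hk2 := h2 i
  have key : ∀ φ : ℝ, 0 ≤ φ → φ ≤ 1 → ∀ w : ℝ,
      plFun K (lam w) = (K i : ℝ) + ((K (i + 1) : ℝ) - K i) * ((c + φ) / 2 ^ (κ + 1) - i) →
      lam w = (c + φ) / 2 ^ (κ + 1) := by
    intro φ h0 h1 w hw
    apply (plFun_strictMono hK).injective
    rw [hw, plFun_eq K i]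
    · rw [le_div_iff₀ hpr]; linarith
    · rw [div_le_iff₀ hpr]; linarith
  rcases (show K (i + 1) = K i + 1 ∨ K (i + 1) = K i + 2 by omega) with e | e
  · obtain ⟨m, hm⟩ := Int.even_or_odd' ((K i - i) * 2 ^ (κ + 1) + c)
    obtain ⟨a, l, hl, hh⟩ := h m
    rcases hm with hm | hm
    · refine ⟨2 * a, l + 1, by omega, fun φ h0 h1 => ?_⟩
      apply key φ h0 h1
      have : ((2 * a : ℤ) + φ) / 2 ^ (l + 1) = (a + φ / 2) / 2 ^ l := by
        rw [pow_succ]; push_cast; field_simp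
      have := (congrArg (fun x => plFun K (lam x)) this).trans (hh (φ / 2) (by linarith) (by linarith))
      refine this.trans ?_
      rw [e]
      have hm' : ((K i : ℝ) - i) * 2 ^ (κ + 1) + c = 2 * m := by exact_mod_cast hm
      rw [pow_succ] at *
      push_cast; field_simp; linarith
    · refine ⟨2 * a + 1, l + 1, by omega, fun φ h0 h1 => ?_⟩
      apply key φ h0 h1
      have : ((2 * a + 1 : ℤ) + φ) / 2 ^ (l + 1) = (a + (1 + φ) / 2) / 2 ^ l := by
        rw [pow_succ]; push_cast; field_simp; ring
      have := (congrArg (fun x => plFun K (lam x)) this).trans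
        (hh ((1 + φ) / 2) (by linarith) (by linarith))
      refine this.trans ?_
      rw [e]
      have hm' : ((K i : ℝ) - i) * 2 ^ (κ + 1) + c = 2 * m + 1 := by exact_mod_cast hm
      rw [pow_succ] at *
      push_cast; field_simp; linarith
  · obtain ⟨a, l, hl, hh⟩ := h (c + (K i - 2 * i) * 2 ^ κ)
    refine ⟨a, l, by omega, fun φ h0 h1 => ?_⟩
    apply key φ h0 h1
    refine (hh φ h0 h1).trans ?_
    rw [e, pow_succ]; push_cast; field_simp; ring

def Im (N : ℕ) (lam : ℝ ≃o ℝ) (v : ℝ) : Prop := ∃ j : ℤ, lam (j / 2 ^ N) = v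

lemma SD_between {N : ℕ} {lam : ℝ ≃o ℝ} (h : SD N lam) :
    (∀ i : ℤ, Im N lam i) ∧ (∀ v, Im N lam v → ∃ k, IsDy k v) ∧
    ∀ v v', Im N lam v → Im N lam v' → v < v' → dep v = dep v' → 1 ≤ dep v →
      ∃ e, Im N lam e ∧ v < e ∧ e < v' ∧ dep e < dep v := by
  obtain ⟨κ, h⟩ := h
  have hpr : (0:ℝ) < 2 ^ κ := by positivity
  -- structure on each interval
  have st : ∀ c : ℤ, ∃ m : ℕ, ∀ φ : ℝ, 0 ≤ φ → φ ≤ 1 →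
      (Im N lam ((c + φ) / 2 ^ κ) ↔ IsDy m φ) := by
    intro c
    obtain ⟨a, l, hl, hh⟩ := h c
    obtain ⟨m, rfl⟩ := Nat.exists_eq_add_of_le hl
    refine ⟨m, fun φ h0 h1 => ?_⟩
    constructor
    · rintro ⟨j, hj⟩
      rw [← hh φ h0 h1] at hj
      have := lam.injective hj
      refine ⟨j - a * 2 ^ m, ?_⟩
      rw [pow_add] at this
      field_simp at this
      push_cast; field_simp; linarith
    · rintro ⟨b, rfl⟩
      refine ⟨a * 2 ^ m + b, ?_⟩
      rw [← hh _ h0 h1]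
      congr 1
      rw [pow_add]; push_cast; field_simp
  have dk : ∀ v, IsDy κ v → Im N lam v := by
    rintro v ⟨c, rfl⟩
    obtain ⟨m, hm⟩ := st c
    have := (hm 0 le_rfl zero_le_one).2 ⟨0, by simp⟩
    simpa using this
  have split : ∀ v : ℝ, v = (⌊v * 2 ^ κ⌋ + Int.fract (v * 2 ^ κ)) / 2 ^ κ := by
    intro v; rw [Int.floor_add_fract]; field_simp
  have dyadd : ∀ (C : ℤ) (m : ℕ) (φ : ℝ), IsDy m φ → IsDy (κ + m) ((C + φ) / 2 ^ κ) := by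
    rintro C m φ ⟨b, rfl⟩
    exact ⟨C * 2 ^ m + b, by rw [pow_add]; push_cast; field_simp⟩
  refine ⟨fun i => dk _ (IsDy.mono (k := 0) ⟨i, by simp⟩ (Nat.zero_le _)), ?_, ?_⟩
  · intro v hv
    obtain ⟨m, hm⟩ := st ⌊v * 2 ^ κ⌋
    rw [split v, hm _ (Int.fract_nonneg _) (Int.fract_lt_one _).le] at hv
    have := dyadd ⌊v * 2 ^ κ⌋ m _ hv
    rw [← split v] at this
    exact ⟨_, this⟩
  · intro v v' hv hv' hlt hd hp
    obtain ⟨m, hm⟩ := st ⌊v * 2 ^ κ⌋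
    have hφ := hv
    rw [split v, hm _ (Int.fract_nonneg _) (Int.fract_lt_one _).le] at hφ
    have dv := dyadd ⌊v * 2 ^ κ⌋ m _ hφ
    rw [← split v] at dv
    obtain ⟨m', hm'⟩ := st ⌊v' * 2 ^ κ⌋
    have hφ' := hv'
    rw [split v', hm' _ (Int.fract_nonneg _) (Int.fract_lt_one _).le] at hφ'
    have dv' := dyadd ⌊v' * 2 ^ κ⌋ m' _ hφ'
    rw [← split v'] at dv'
    obtain ⟨c, hc⟩ := dep_odd dv hp
    obtain ⟨c', hc'⟩ := dep_odd dv' (hd ▸ hp)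
    rw [← hd] at hc'
    obtain ⟨k, hk⟩ := Nat.exists_eq_add_of_le hp
    rw [hk] at hc hc'
    have p2 : (0:ℝ) < 2 ^ (1 + k) := by positivity
    have hcc : c < c' := by
      rw [hc, hc', div_lt_div_iff_of_pos_right p2] at hlt
      have : (c : ℝ) < c' := by linarith
      exact_mod_cast this
    have hcr : (c : ℝ) + 1 ≤ c' := by exact_mod_cast hcc
    -- candidate e
    have e1 : v < (c + 1 : ℤ) / 2 ^ k := by
      rw [hc, pow_add, div_lt_div_iff₀ (by positivity) (by positivity)]
      push_cast
      have : (0:ℝ) < 2 ^ k := by positivity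
      nlinarith
    have e2 : (c + 1 : ℤ) / 2 ^ k < v' := by
      rw [hc', pow_add, div_lt_div_iff₀ (by positivity) (by positivity)]
      push_cast
      have : (0:ℝ) < 2 ^ k := by positivity
      nlinarith
    have e3 : IsDy k (((c + 1 : ℤ) : ℝ) / 2 ^ k) := ⟨c + 1, rfl⟩
    have e4 := dep_le e3
    by_cases hkk : k ≤ κ
    · exact ⟨_, dk _ (e3.mono hkk), e1, e2, by omega⟩
    rcases (Int.floor_mono (mul_le_mul_of_nonneg_right hlt.le hpr.le) :
      ⌊v * 2 ^ κ⌋ ≤ ⌊v' * 2 ^ κ⌋).lt_or_eq with hl | hl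
    · have d1 : IsDy κ (((⌊v * 2 ^ κ⌋ + 1 : ℤ) : ℝ) / 2 ^ κ) := ⟨_, rfl⟩
      have d2 := dep_le d1
      refine ⟨_, dk _ d1, ?_, ?_, by omega⟩
      · rw [lt_div_iff₀ hpr]; push_cast; exact Int.lt_floor_add_one _
      · apply lt_of_le_of_ne
        · rw [div_le_iff₀ hpr]
          exact Int.le_floor.1 (by omega)
        · intro he
          rw [he] at d2; omega
    · refine ⟨_, ?_, e1, e2, by omega⟩
      have f1 := Int.floor_le (v * 2 ^ κ)
      have f2 := Int.lt_floor_add_one (v' * 2 ^ κ)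
      rw [← hl] at f2
      have eq : ((c + 1 : ℤ) : ℝ) / 2 ^ k =
          (⌊v * 2 ^ κ⌋ + (((c + 1 : ℤ) : ℝ) / 2 ^ k * 2 ^ κ - ⌊v * 2 ^ κ⌋)) / 2 ^ κ := by
        field_simp; ring
      rw [eq, hm]
      · have d3 := dep_le dv
        obtain ⟨x, hx⟩ := Nat.exists_eq_add_of_le (show κ ≤ k by omega)
        have : IsDy x (((c + 1 : ℤ) : ℝ) / 2 ^ k * 2 ^ κ - ⌊v * 2 ^ κ⌋) :=
          ⟨c + 1 - ⌊v * 2 ^ κ⌋ * 2 ^ x, by rw [hx, pow_add]; push_cast; field_simp⟩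
        exact this.mono (by omega)
      · have := mul_lt_mul_of_pos_right e1 hpr
        linarith
      · have := mul_lt_mul_of_pos_right e2 hpr
        linarith

lemma SD_valid {τ : ℤ → ℝ} (hτ : IsCfg τ) {N : ℕ} {lam : ℝ ≃o ℝ} (hSD : SD N lam) {s : ℝ}
    {a b : ℤ} (hab : a < b) (ga : 0 < Gf τ (lam (a / 2 ^ N)) + s)
    (gb : 0 < Gf τ (lam (b / 2 ^ N)) + s) (hs : 0 ≤ s) :
    (∃ c, a ≤ c ∧ c ≤ b ∧ 1 ≤ Gf τ (lam (c / 2 ^ N)) + s) ∨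
    ∃ c c', a ≤ c ∧ c < c' ∧ c' ≤ b ∧
      1 ≤ (Gf τ (lam (c / 2 ^ N)) + s) + (Gf τ (lam (c' / 2 ^ N)) + s) := by
  obtain ⟨hi, hd, hbt⟩ := SD_between hSD
  have hp : (0:ℝ) < 2 ^ N := by positivity
  have cmp : ∀ x y : ℤ, lam (x / 2 ^ N) < lam (y / 2 ^ N) ↔ x < y := by
    intro x y
    rw [lam.lt_iff_lt, div_lt_div_iff_of_pos_right hp]; exact_mod_cast Iff.rfl
  have cmp' : ∀ x y : ℤ, lam (x / 2 ^ N) ≤ lam (y / 2 ^ N) ↔ x ≤ y := by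
    intro x y
    rw [lam.le_iff_le, div_le_div_iff_of_pos_right hp]; exact_mod_cast Iff.rfl
  have hlt := (cmp a b).2 hab
  set va := lam (a / 2 ^ N) with hva
  set vb := lam (b / 2 ^ N) with hvb
  obtain ⟨ka, da⟩ := hd va ⟨a, rfl⟩
  obtain ⟨kb, db⟩ := hd vb ⟨b, rfl⟩
  by_cases ia : (⌊va⌋ : ℝ) = va
  · by_cases ib : (⌊vb⌋ : ℝ) = vb
    · right
      obtain ⟨c', hc'⟩ := hi (⌊va⌋ + 1)
      have hl : ⌊va⌋ < ⌊vb⌋ := by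
        rw [← ia, ← ib] at hlt; exact_mod_cast hlt
      have hl' : ((⌊va⌋ + 1 : ℤ) : ℝ) ≤ ⌊vb⌋ := by exact_mod_cast hl
      refine ⟨a, c', le_rfl, ?_, ?_, ?_⟩
      · rw [← cmp, hc', ← hva]; push_cast; linarith
      · rw [← cmp', hc', ← hvb]; linarith
      · rw [hc', ← hva, ← ia, Gf_int]
        simp only [Int.floor_intCast]
        rw [Gf_int]
        have := hτ.2 (⌊va⌋ - 1)
        rw [show ⌊va⌋ - 1 + 2 = ⌊va⌋ + 1 by ring] at this
        rw [add_sub_cancel_right]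
        linarith
    · left
      obtain ⟨c, hc⟩ := hi ⌊vb⌋
      refine ⟨c, ?_, ?_, ?_⟩
      · rw [← cmp', hc, ← hva, ← ia]
        exact_mod_cast Int.floor_mono hlt.le
      · rw [← cmp', hc, ← hvb]; exact Int.floor_le _
      · rw [hc, Gf_int]
        rw [Gf_nonint τ ib] at gb
        have := dep_pos db ib
        have : (1:ℝ) ≤ dep vb := by exact_mod_cast this
        have : rr τ ⌊vb⌋ ≤ τ ⌊vb⌋ - τ (⌊vb⌋ - 1) := (min_le_right _ _).trans (min_le_right _ _)
        linarith
  · left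
    rw [Gf_nonint τ ia] at ga
    have pa := dep_pos da ia
    have pa' : (1:ℝ) ≤ dep va := by exact_mod_cast pa
    by_cases hb : (⌊va⌋ : ℝ) + 1 ≤ vb
    · obtain ⟨c, hc⟩ := hi (⌊va⌋ + 1)
      refine ⟨c, ?_, ?_, ?_⟩
      · rw [← cmp', hc, ← hva]; push_cast; exact (Int.lt_floor_add_one _).le
      · rw [← cmp', hc, ← hvb]; push_cast; exact hb
      · rw [hc, Gf_int, add_sub_cancel_right]
        have : rr τ ⌊va⌋ ≤ τ (⌊va⌋ + 1) - τ ⌊va⌋ := (min_le_right _ _).trans (min_le_left _ _)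
        linarith
    · push Not at hb
      have fa : (⌊va⌋ : ℝ) < va := lt_of_le_of_ne (Int.floor_le _) ia
      have nonint : ∀ e : ℝ, (⌊va⌋ : ℝ) < e → e < ⌊va⌋ + 1 → ⌊e⌋ = ⌊va⌋ ∧ (⌊e⌋ : ℝ) ≠ e := by
        intro e h1 h2
        have : ⌊e⌋ = ⌊va⌋ := Int.floor_eq_iff.2 ⟨h1.le, h2⟩
        exact ⟨this, by rw [this]; exact h1.ne⟩
      obtain ⟨fb, ib⟩ := nonint vb (by linarith) hb
      rw [Gf_nonint τ ib, fb] at gb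
      rcases lt_trichotomy (dep va) (dep vb) with hh | hh | hh
      · refine ⟨a, le_rfl, hab.le, ?_⟩
        have : (dep va : ℝ) + 1 ≤ dep vb := by exact_mod_cast hh
        rw [← hva, Gf_nonint τ ia]; linarith
      · obtain ⟨e, ⟨j, hj⟩, h1, h2, h3⟩ := hbt va vb ⟨a, rfl⟩ ⟨b, rfl⟩ hlt hh pa
        obtain ⟨fe, ie⟩ := nonint e (by linarith) (by linarith)
        refine ⟨j, ?_, ?_, ?_⟩
        · rw [← cmp', hj]; exact h1.le
        · rw [← cmp', hj]; exact h2.le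
        · rw [hj, Gf_nonint τ ie, fe]
          have : (dep e : ℝ) + 1 ≤ dep va := by exact_mod_cast h3
          linarith
      · refine ⟨b, hab.le, le_rfl, ?_⟩
        have : (dep vb : ℝ) + 1 ≤ dep va := by exact_mod_cast hh
        rw [← hvb, Gf_nonint τ ib, fb]; linarith

lemma CFset_iff {n : ℕ} (t : Fin n → ℝ) : t ∈ CFset n ↔ Monotone t ∧
    ∀ a b : Fin n, (a:ℕ) + 2 ≤ b → 1 ≤ t b - t a := by
  constructor
  · rintro ⟨hm, h⟩
    refine ⟨hm, fun a b hab => ?_⟩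
    have h1 := h a (lt_of_le_of_lt hab b.2)
    have h2 : t ⟨a + 2, lt_of_le_of_lt hab b.2⟩ ≤ t b := hm (by
      rw [Fin.le_def]; exact hab)
    have h3 : t ⟨a, by omega⟩ = t a := rfl
    linarith
  · rintro ⟨hm, h⟩
    exact ⟨hm, fun i hi => h _ _ (by simp)⟩

lemma range_dup {n : ℕ} (t : Fin (n + 1) → ℝ) (i : Fin (n + 1)) :
    Set.range (dup t i) = Set.range t := by
  unfold dup
  ext x
  constructor
  · rintro ⟨j, rfl⟩
    refine Fin.succAboveCases i.castSucc ?_ (fun k => ?_) j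
    · simp
    · simp
  · rintro ⟨k, rfl⟩
    exact ⟨i.castSucc.succAbove k, by simp⟩

noncomputable def pts : CF → Finset ℝ :=
  Quot.lift (fun x => Finset.univ.image x.2.1) (by
    rintro x y ⟨i, h, rfl⟩
    apply Finset.coe_injective
    simp only [Finset.coe_image, Finset.coe_univ, Set.image_univ]
    exact (range_dup _ i).symm)

lemma strict_rep (n : ℕ) (t : CFn (n + 1)) : ∃ (m : ℕ) (s : CFn (m + 1)), StrictMono s.1 ∧
    (Quot.mk CFrel ⟨n, t⟩ : CF) = Quot.mk CFrel ⟨m, s⟩ := by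
  induction n with
  | zero =>
    refine ⟨0, t, fun a b hab => absurd hab (by rw [Fin.lt_def]; omega), rfl⟩
  | succ n ih =>
    by_cases hs : StrictMono t.1
    · exact ⟨n + 1, t, hs, rfl⟩
    rw [Fin.strictMono_iff_lt_succ] at hs
    push Not at hs
    obtain ⟨j, hj⟩ := hs
    obtain ⟨hm, hg⟩ := (CFset_iff _).1 t.2
    have heq : t.1 j.castSucc = t.1 j.succ := le_antisymm (hm (Fin.castSucc_le_succ j)) hj
    let t' : Fin (n + 1) → ℝ := fun k => t.1 (j.castSucc.succAbove k)
    have hd : dup t' j = t.1 := by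
      unfold dup
      have : t' j = t.1 j.castSucc := by
        show t.1 (j.castSucc.succAbove j) = _
        rw [heq]
        simp
      rw [this]
      exact Fin.insertNth_self_removeNth j.castSucc t.1
    have ht' : t' ∈ CFset (n + 1) := by
      rw [CFset_iff]
      refine ⟨fun a b hab => hm ((Fin.strictMono_succAbove _).monotone hab), fun a b hab => ?_⟩
      apply hg
      have hb : (a : ℕ) + 1 < n + 1 := by have := b.2; omega
      have h1 : j.castSucc.succAbove a < j.castSucc.succAbove ⟨a + 1, hb⟩ :=
        Fin.strictMono_succAbove _ (by rw [Fin.lt_def]; simp)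
      have h2 : j.castSucc.succAbove ⟨a + 1, hb⟩ < j.castSucc.succAbove b :=
        Fin.strictMono_succAbove _ (by rw [Fin.lt_def]; simp; omega)
      rw [Fin.lt_def] at h1 h2
      omega
    obtain ⟨m, s, h1, h2⟩ := ih ⟨t', ht'⟩
    refine ⟨m, s, h1, ?_⟩
    rw [← h2]
    symm
    apply Quot.sound
    refine ⟨j, ?_, ?_⟩
    · show dup t' j ∈ _
      rw [hd]; exact t.2
    · have : t = ⟨dup t' j, by rw [hd]; exact t.2⟩ := Subtype.ext hd.symm
      exact congrArg (fun z => (⟨n + 1, z⟩ : PreCF)) this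

lemma strict_rep' (c : CF) : ∃ (m : ℕ) (s : CFn (m + 1)), StrictMono s.1 ∧
    c = Quot.mk CFrel ⟨m, s⟩ := by
  induction c using Quot.ind with
  | mk x => exact strict_rep x.1 x.2

lemma pts_mk (n : ℕ) (t : CFn (n + 1)) : pts (Quot.mk CFrel ⟨n, t⟩) = Finset.univ.image t.1 := rfl

lemma mem_pts (n : ℕ) (t : CFn (n + 1)) (x : ℝ) :
    x ∈ pts (Quot.mk CFrel ⟨n, t⟩) ↔ ∃ i, t.1 i = x := by
  rw [pts_mk]; simp

lemma pts_injective : Function.Injective pts := by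
  intro c d h
  obtain ⟨m, s, hs, rfl⟩ := strict_rep' c
  obtain ⟨m', s', hs', rfl⟩ := strict_rep' d
  rw [pts_mk, pts_mk] at h
  have c1 : (Finset.univ.image s.1).card = m + 1 := by
    rw [Finset.card_image_of_injective _ hs.injective]; simp
  have c2 : (Finset.univ.image s'.1).card = m' + 1 := by
    rw [Finset.card_image_of_injective _ hs'.injective]; simp
  have hmm : m = m' := by rw [h] at c1; omega
  subst hmm
  have e1 := Finset.orderEmbOfFin_unique c1 (f := s.1) (fun x => by simp) hs
  have e2 := Finset.orderEmbOfFin_unique c1 (f := s'.1) (fun x => by rw [h]; simp) hs'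
  have : s = s' := Subtype.ext (e1.trans e2.symm)
  rw [this]

structure IsSeq (S : Finset ℝ) (n : ℤ) (τ : ℤ → ℝ) : Prop where
  pos : 1 ≤ n
  cfg : IsCfg τ
  mem : ∀ x, x ∈ S ↔ ∃ i, 0 ≤ i ∧ i < n ∧ τ i = x
  low : ∀ i, i ≤ 0 → τ i = τ 0 + i
  high : ∀ i, n - 1 ≤ i → τ i = τ (n - 1) + (i - (n - 1))

lemma exists_seq (c : CF) : ∃ n τ, IsSeq (pts c) n τ := by
  obtain ⟨m, s, hs, rfl⟩ := strict_rep' c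
  obtain ⟨hm, hg⟩ := (CFset_iff _).1 s.2
  let p : ℤ → Fin (m + 1) := fun i => ⟨(min i m).toNat, by omega⟩
  let τ : ℤ → ℝ := fun i => s.1 (p i) + (i - ((p i : ℕ) : ℤ))
  have pv : ∀ i, ((p i : ℕ) : ℤ) = max 0 (min i m) := by intro i; simp [p]; omega
  have step : ∀ i, (τ (i + 1) - τ i = 1) ∨
      ((p (i + 1) : ℕ) = p i + 1 ∧ τ (i + 1) - τ i = s.1 (p (i + 1)) - s.1 (p i)) := by
    intro i
    have h1 := pv i
    have h2 := pv (i + 1)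
    by_cases hi : 0 ≤ i ∧ i < m
    · right
      have e : (p (i + 1) : ℕ) = p i + 1 := by omega
      refine ⟨e, ?_⟩
      simp only [τ]; rw [e]; push_cast; ring
    · left
      have e : p (i + 1) = p i := by apply Fin.ext; omega
      simp only [τ]; rw [e]; push_cast; ring
  have sm : ∀ i, τ i < τ (i + 1) := by
    intro i
    rcases step i with h | ⟨h1, h2⟩
    · linarith
    · have : s.1 (p i) < s.1 (p (i + 1)) := hs (by rw [Fin.lt_def]; omega)
      linarith
  have smm : StrictMono τ := strictMono_int_of_lt_succ sm
  have τin : ∀ i : ℤ, 0 ≤ i → i < m + 1 → τ i = s.1 (p i) := by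
    intro i h0 h1
    have h2 := pv i
    have : ((p i : ℕ) : ℤ) = i := by omega
    simp only [τ]; rw [this]; simp
  refine ⟨m + 1, τ, ?_, ⟨smm, ?_⟩, ?_, ?_, ?_⟩
  · omega
  · intro i
    have e : i + 1 + 1 = i + 2 := by ring
    have s1 := sm i
    have s2 := sm (i + 1)
    have st1 := step i
    have st2 := step (i + 1)
    rw [e] at s2 st2
    rcases st1 with h | ⟨h1, h2⟩
    · linarith
    · rcases st2 with h' | ⟨h1', h2'⟩
      · linarith
      · have := hg (p i) (p (i + 2)) (by omega)
        linarith
  · intro x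
    rw [mem_pts]
    constructor
    · rintro ⟨i, rfl⟩
      refine ⟨(i : ℕ), by omega, by have := i.2; omega, ?_⟩
      rw [τin _ (by omega) (by have := i.2; omega)]
      have e : p ((i : ℕ) : ℤ) = i := by
        apply Fin.ext
        have := pv ((i : ℕ) : ℤ)
        have := i.2
        omega
      rw [e]
    · rintro ⟨i, h0, h1, rfl⟩
      exact ⟨p i, (τin i h0 h1).symm⟩
  · intro i hi
    have h1 := pv i
    have h2 := pv 0
    have e : p i = p 0 := by apply Fin.ext; omega
    have e0 : (p 0 : ℕ) = 0 := by omega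
    simp only [τ]; rw [e, e0]; simp
  · intro i hi
    rw [add_sub_cancel_right] at *
    have h1 := pv i
    have h2 := pv m
    have e : p i = p m := by apply Fin.ext; omega
    have e0 : (p m : ℕ) = m := by omega
    simp only [τ]; rw [e, e0]; push_cast; ring

noncomputable def num (c : CF) : ℤ := (exists_seq c).choose
noncomputable def tau (c : CF) : ℤ → ℝ := (exists_seq c).choose_spec.choose
lemma tau_spec (c : CF) : IsSeq (pts c) (num c) (tau c) := (exists_seq c).choose_spec.choose_spec

lemma exists_rad {S : Finset ℝ} {n : ℤ} {τ : ℤ → ℝ} (h : IsSeq S n τ) : ∃ ρ, SepCfg ρ τ := by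
  obtain ⟨i0, hi0, hmin⟩ := Finset.exists_min_image (Finset.Ico 0 n) (fun i => τ (i + 1) - τ i)
    ⟨0, by simp; have := h.pos; omega⟩
  have hpos : 0 < τ (i0 + 1) - τ i0 := sub_pos.2 (h.cfg.1 (by omega))
  have hone : τ (i0 + 1) - τ i0 ≤ 1 := by
    have h1 := hmin (n - 1) (by simp; have := h.pos; omega)
    have h2 := h.high n (by omega)
    rw [sub_add_cancel, h2] at h1
    linarith
  refine ⟨(τ (i0 + 1) - τ i0) / 16, by positivity, by linarith, fun i => ?_⟩
  by_cases hi : 0 ≤ i ∧ i < n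
  · have := hmin i (by simp; exact hi)
    linarith
  · have : τ (i + 1) - τ i = 1 := by
      rcases not_and_or.1 hi with hh | hh
      · rw [h.low i (by omega), h.low (i + 1) (by omega)]; push_cast; ring
      · rw [h.high i (by omega), h.high (i + 1) (by omega)]; push_cast; ring
    linarith

noncomputable def rad (c : CF) : ℝ := (exists_rad (tau_spec c)).choose
lemma rad_spec (c : CF) : SepCfg (rad c) (tau c) := (exists_rad (tau_spec c)).choose_spec

def Near (ρ : ℝ) (S S' : Finset ℝ) : Prop :=
  (∀ x ∈ S, ∃ y ∈ S', |y - x| < ρ) ∧ ∀ y ∈ S', ∃ x ∈ S, |y - x| < ρ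

lemma near_self {ρ : ℝ} (hρ : 0 < ρ) (S : Finset ℝ) : Near ρ S S :=
  ⟨fun x hx => ⟨x, hx, by simpa⟩, fun x hx => ⟨x, hx, by simpa⟩⟩

lemma isOpen_near (ρ : ℝ) (S : Finset ℝ) : IsOpen {c : CF | Near ρ S (pts c)} := by
  have hq : IsQuotientMap (Quot.mk CFrel) := isQuotientMap_quot_mk
  rw [← hq.isOpen_preimage, isOpen_sigma_iff]
  intro n
  have : ((fun t : CFn (n + 1) => (⟨n, t⟩ : PreCF)) ⁻¹'
      (Quot.mk CFrel ⁻¹' {c : CF | Near ρ S (pts c)})) =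
      (⋂ x ∈ S, ⋃ j, {t : CFn (n + 1) | |t.1 j - x| < ρ}) ∩
      ⋂ j, ⋃ x ∈ S, {t : CFn (n + 1) | |t.1 j - x| < ρ} := by
    ext t
    simp only [Set.mem_preimage, Set.mem_ofPred_eq, Near, mem_pts, Set.mem_inter_iff, Set.mem_iInter,
      Set.mem_iUnion]
    constructor
    · rintro ⟨h1, h2⟩
      refine ⟨fun x hx => ?_, fun j => ?_⟩
      · obtain ⟨y, ⟨j, rfl⟩, hy⟩ := h1 x hx
        exact ⟨j, hy⟩
      · obtain ⟨x, hx, hh⟩ := h2 _ ⟨j, rfl⟩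
        exact ⟨x, hx, hh⟩
    · rintro ⟨h1, h2⟩
      refine ⟨fun x hx => ?_, ?_⟩
      · obtain ⟨j, hj⟩ := h1 x hx
        exact ⟨_, ⟨j, rfl⟩, hj⟩
      · rintro y ⟨j, rfl⟩
        obtain ⟨x, hx, hh⟩ := h2 j
        exact ⟨x, hx, hh⟩
  refine (congrArg IsOpen this).mpr ?_
  have ho : ∀ (j : Fin (n + 1)) (x : ℝ), IsOpen {t : CFn (n + 1) | |t.1 j - x| < ρ} := by
    intro j x
    exact isOpen_lt ((((continuous_apply j).comp continuous_subtype_val).sub continuous_const).abs)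
      continuous_const
  refine IsOpen.inter ?_ ?_
  · exact isOpen_biInter_finset fun x _ => isOpen_iUnion fun j => ho j x
  · exact isOpen_iInter_of_finite fun j => isOpen_biUnion fun x _ => ho j x

lemma match_exists {ρ : ℝ} {τ τ' : ℤ → ℝ} (hs : SepCfg ρ τ) (hm' : StrictMono τ')
    (h1 : ∀ l, ∃ i, |τ' l - τ i| < ρ) (h2 : ∀ i, ∃ l, |τ' l - τ i| < ρ) :
    ∃ K, Match ρ τ τ' K := by
  choose f hf using h1
  have hρ := hs.1
  have funiq : ∀ l i, |τ' l - τ i| < ρ → f l = i := fun l i h =>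
    hs.uniq (y := τ' l) (by linarith [hf l]) (by linarith)
  have fsurj : ∀ i, ∃ l, f l = i := fun i => by
    obtain ⟨l, hl⟩ := h2 i; exact ⟨l, funiq l i hl⟩
  have fmono : Monotone f := by
    intro a b hab
    by_contra hlt
    push Not at hlt
    have e1 := hs.far hlt
    have e2 := hf a
    have e3 := hf b
    have e4 := hm'.monotone hab
    rw [abs_lt] at e2 e3
    linarith
  have hleast : ∀ i, ∃ l, i ≤ f l ∧ ∀ z, i ≤ f z → l ≤ z := by
    intro i
    obtain ⟨l0, hl0⟩ := fsurj (i - 1)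
    obtain ⟨l1, hl1⟩ := fsurj i
    exact Int.exists_least_of_bdd (P := fun l => i ≤ f l) ⟨l0, fun z hz => by
      by_contra hlt
      have := fmono (not_le.1 hlt).le
      omega⟩ ⟨l1, hl1.ge⟩
  choose K hK1 hK2 using hleast
  have fK : ∀ i, f (K i) = i := by
    intro i
    obtain ⟨l1, hl1⟩ := fsurj i
    have := fmono (hK2 i l1 hl1.ge)
    have := hK1 i
    omega
  refine ⟨K, fun i => ?_, fun i l ha hb => ?_⟩
  · by_contra hlt
    have := fmono (not_lt.1 hlt)
    rw [fK, fK] at this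
    omega
  · have a1 := fmono ha
    rw [fK] at a1
    have a2 : f l < i + 1 := by
      by_contra hlt
      have := hK2 (i + 1) l (not_lt.1 hlt)
      omega
    have : f l = i := by omega
    rw [← this]; exact hf l

lemma match_at {ρ : ℝ} {τ τ' : ℤ → ℝ} {K : ℤ → ℤ} (hs : SepCfg ρ τ) (h : Match ρ τ τ' K) {l i : ℤ}
    (hl : |τ' l - τ i| < ρ) : K i ≤ l ∧ l < K (i + 1) := by
  obtain ⟨j, h1, h2⟩ := blocks h.1 l
  have hρ := hs.1
  have := hs.uniq (y := τ' l) (i := j) (j := i) (by linarith [h.2 j l h1 h2]) (by linarith)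
  rw [← this]; exact ⟨h1, h2⟩

/-- Endpoints of nearby configurations are close. -/
lemma near_ends {ρ : ℝ} {S S' : Finset ℝ} {n n' : ℤ} {τ τ' : ℤ → ℝ} (h : IsSeq S n τ)
    (h' : IsSeq S' n' τ') (hn : Near ρ S S') :
    |τ' 0 - τ 0| < ρ ∧ |τ' (n' - 1) - τ (n - 1)| < ρ := by
  have p := h.pos
  have p' := h'.pos
  obtain ⟨y, hy, h1⟩ := hn.1 (τ 0) ((h.mem _).2 ⟨0, le_rfl, by omega, rfl⟩)
  obtain ⟨x, hx, h2⟩ := hn.2 (τ' 0) ((h'.mem _).2 ⟨0, le_rfl, by omega, rfl⟩)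
  obtain ⟨z, hz, h3⟩ := hn.1 (τ (n - 1)) ((h.mem _).2 ⟨n - 1, by omega, by omega, rfl⟩)
  obtain ⟨w, hw, h4⟩ := hn.2 (τ' (n' - 1)) ((h'.mem _).2 ⟨n' - 1, by omega, by omega, rfl⟩)
  obtain ⟨j1, a1, b1, rfl⟩ := (h'.mem _).1 hy
  obtain ⟨j2, a2, b2, rfl⟩ := (h.mem _).1 hx
  obtain ⟨j3, a3, b3, rfl⟩ := (h'.mem _).1 hz
  obtain ⟨j4, a4, b4, rfl⟩ := (h.mem _).1 hw
  have c1 := h'.cfg.1.monotone a1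
  have c2 := h.cfg.1.monotone a2
  have c3 := h'.cfg.1.monotone (show j3 ≤ n' - 1 by omega)
  have c4 := h.cfg.1.monotone (show j4 ≤ n - 1 by omega)
  rw [abs_lt] at h1 h2 h3 h4
  rw [abs_lt, abs_lt]
  constructor <;> constructor <;> linarith

lemma near_match {ρ : ℝ} {S S' : Finset ℝ} {n n' : ℤ} {τ τ' : ℤ → ℝ} (h : IsSeq S n τ)
    (h' : IsSeq S' n' τ') (hs : SepCfg ρ τ) (hn : Near ρ S S') :
    ∃ K, Match ρ τ τ' K ∧ K 0 = 0 ∧ K n = n' := by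
  obtain ⟨e1, e2⟩ := near_ends h h' hn
  have p := h.pos
  have p' := h'.pos
  have lowc : ∀ i, i ≤ 0 → |τ' i - τ i| < ρ := by
    intro i hi
    rw [h.low i hi, h'.low i hi, add_sub_add_right_eq_sub]; exact e1
  have highc : ∀ i, 0 ≤ i → |τ' (n' - 1 + i) - τ (n - 1 + i)| < ρ := by
    intro i hi
    rw [h.high _ (by omega), h'.high _ (by omega)]
    push_cast
    have : τ' (n' - 1) + ((n':ℝ) - 1 + i - (n' - 1)) - (τ (n - 1) + ((n:ℝ) - 1 + i - (n - 1)))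
      = τ' (n' - 1) - τ (n - 1) := by ring
    rw [this]; exact e2
  obtain ⟨K, hK⟩ := match_exists hs h'.cfg.1 (by
    intro l
    by_cases c1 : l ≤ 0
    · exact ⟨l, lowc l c1⟩
    by_cases c2 : n' - 1 ≤ l
    · refine ⟨n - 1 + (l - (n' - 1)), ?_⟩
      have := highc (l - (n' - 1)) (by omega)
      rwa [show n' - 1 + (l - (n' - 1)) = l by ring] at this
    · obtain ⟨x, hx, hh⟩ := hn.2 (τ' l) ((h'.mem _).2 ⟨l, by omega, by omega, rfl⟩)
      obtain ⟨i, _, _, rfl⟩ := (h.mem _).1 hx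
      exact ⟨i, hh⟩) (by
    intro l
    by_cases c1 : l ≤ 0
    · exact ⟨l, lowc l c1⟩
    by_cases c2 : n - 1 ≤ l
    · refine ⟨n' - 1 + (l - (n - 1)), ?_⟩
      have := highc (l - (n - 1)) (by omega)
      rwa [show n - 1 + (l - (n - 1)) = l by ring] at this
    · obtain ⟨x, hx, hh⟩ := hn.1 (τ l) ((h.mem _).2 ⟨l, by omega, by omega, rfl⟩)
      obtain ⟨i, _, _, rfl⟩ := (h'.mem _).1 hx
      exact ⟨i, hh⟩)
  refine ⟨K, hK, ?_, ?_⟩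
  · have a1 := match_at hs hK (lowc 0 le_rfl)
    have a2 := match_at hs hK (lowc (-1) (by omega))
    rw [show (-1:ℤ) + 1 = 0 by ring] at a2
    omega
  · have a1 := match_at hs hK (highc 0 le_rfl)
    have a2 := match_at hs hK (highc 1 (by omega))
    rw [show n - 1 + 0 + 1 = n by ring] at a1
    rw [show n - 1 + 1 = n by ring] at a2
    omega

open Classical in
noncomputable def th (c d : CF) : ℝ ≃o ℝ :=
  if h : ∃ K, Match (rad c) (tau c) (tau d) K then pl h.choose h.choose_spec.1 else 1

lemma th_eq {c d : CF} {K : ℤ → ℤ} (hK : Match (rad c) (tau c) (tau d) K) :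
    th c d = pl K hK.1 := by
  have h : ∃ K, Match (rad c) (tau c) (tau d) K := ⟨K, hK⟩
  have hρ := (rad_spec c).1
  have e : h.choose = K := match_unique (rad_spec c) (h.choose_spec.mono (by linarith))
    (hK.mono (by linarith))
  unfold th
  rw [dif_pos h]
  congr

lemma SepCfg.mono {ρ r : ℝ} {τ : ℤ → ℝ} (h : SepCfg ρ τ) (h0 : 0 < r) (hr : r ≤ ρ) : SepCfg r τ :=
  ⟨h0, hr.trans h.2.1, fun i => by linarith [h.2.2 i]⟩

lemma th_near {c d : CF} {r : ℝ} (h0 : 0 < r) (hr : r ≤ rad c) (hn : Near r (pts c) (pts d)) :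
    ∃ (K : ℤ → ℤ) (hK : ∀ i, K i < K (i + 1)), Match r (tau c) (tau d) K ∧ K 0 = 0 ∧
      K (num c) = num d ∧ th c d = pl K hK ∧ ∀ i, K (i + 1) ≤ K i + 2 := by
  have hs := (rad_spec c).mono h0 hr
  obtain ⟨K, hK, k0, k1⟩ := near_match (tau_spec c) (tau_spec d) hs hn
  exact ⟨K, hK.1, hK, k0, k1, th_eq (hK.mono hr),
    match_le2 (by linarith [hs.2.1]) hK (tau_spec d).cfg⟩

lemma th_self (c : CF) : th c c = 1 := by
  have hρ := (rad_spec c).1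
  have : Match (rad c) (tau c) (tau c) (fun i => i) := ⟨fun i => by show i < i + 1; omega, fun i l h1 h2 => by
    change i ≤ l at h1
    change l < i + 1 at h2
    have : l = i := by omega
    rw [this]; simpa using hρ⟩
  rw [th_eq this]
  ext u
  simp only [pl_apply, plFun]
  push_cast
  have := Int.floor_add_fract u
  show _ = u
  linarith

lemma th_coc (c d e : CF) (hd : Near (rad c) (pts c) (pts d))
    (he : Near (min (rad c) (rad d)) (pts d) (pts e)) (hce : Near (rad c) (pts c) (pts e)) :
    th c e = th d e * th c d := by
  have pc := (rad_spec c).1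
  have pd := (rad_spec d).1
  obtain ⟨K, hK, mK, -, -, tK, sK⟩ := th_near pc le_rfl hd
  obtain ⟨K', hK', mK', -, -, tK', sK'⟩ := th_near (lt_min pc pd) (min_le_right _ _) he
  obtain ⟨L, hL, mL, -, -, tL, sL⟩ := th_near pc le_rfl hce
  have mc := match_comp mK mK' (R := 2 * rad c) (by linarith [min_le_left (rad c) (rad d)])
  have eq : K' ∘ K = L := match_unique (rad_spec c) mc (mL.mono (by linarith))
  subst eq
  rw [tL, tK, tK', pl_comp hK hK' sL]

lemma near_nhds {A : Type*} [TopologicalSpace A] {f : A → CF} (hf : Continuous f) (a : A) {r : ℝ}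
    (hr : 0 < r) : ∀ᶠ b in 𝓝 a, Near r (pts (f a)) (pts (f b)) :=
  ((isOpen_near r (pts (f a))).preimage hf).mem_nhds (near_self hr _)

def qq (w : ℝ × (ℕ → ℝ)) (j : ℕ) : ℝ := w.1 + ∑ l ∈ Finset.range j, max 0 (w.2 l)

lemma qq_continuous (j : ℕ) : Continuous fun w : ℝ × (ℕ → ℝ) => qq w j := by
  unfold qq
  refine continuous_fst.add (continuous_finsetSum _ fun l _ => continuous_const.max ?_)
  exact (continuous_apply l).comp continuous_snd

lemma qq_mono (w : ℝ × (ℕ → ℝ)) : Monotone (qq w) := by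
  refine monotone_nat_of_le_succ fun j => ?_
  unfold qq
  rw [Finset.sum_range_succ]
  linarith [le_max_left 0 (w.2 j)]

lemma qq_sub (w : ℝ × (ℕ → ℝ)) {a b : ℕ} (h : a ≤ b) :
    qq w b - qq w a = ∑ l ∈ Finset.Ico a b, max 0 (w.2 l) := by
  unfold qq
  rw [Finset.sum_Ico_eq_sub _ h]; ring

def OKw (m : ℕ) (w : ℝ × (ℕ → ℝ)) : Prop :=
  ∀ a b, a < b → b < m → 0 < w.2 a → 0 < w.2 b → 1 ≤ ∑ l ∈ Finset.Ico a (b + 1), max 0 (w.2 l)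

def Wset (m : ℕ) : Set (ℝ × (ℕ → ℝ)) := {w | ∀ s : ℝ, 0 ≤ s → OKw m (w.1, fun l => w.2 l + s)}

lemma Wset_OK {m : ℕ} {w : ℝ × (ℕ → ℝ)} (h : w ∈ Wset m) : OKw m w := by
  have := h 0 le_rfl
  simpa using this

lemma CFset_closed (n : ℕ) : IsClosed (CFset n) := by
  have : CFset n = (⋂ a : Fin n, ⋂ b : Fin n, ⋂ _ : a ≤ b, {t | t a ≤ t b}) ∩
      ⋂ a : Fin n, ⋂ b : Fin n, ⋂ _ : (a:ℕ) + 2 ≤ b, {t | 1 ≤ t b - t a} := by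
    ext t
    rw [CFset_iff]
    simp [Monotone]
  rw [this]
  refine IsClosed.inter ?_ ?_
  · exact isClosed_iInter fun a => isClosed_iInter fun b => isClosed_iInter fun _ =>
      isClosed_le (continuous_apply a) (continuous_apply b)
  · exact isClosed_iInter fun a => isClosed_iInter fun b => isClosed_iInter fun _ =>
      isClosed_le continuous_const ((continuous_apply b).sub (continuous_apply a))

abbrev Idx (m : ℕ) := (k : Fin (m + 1)) × (Fin (k + 1) → Fin (m + 1))

def Cc (m : ℕ) (x : Idx m) : Set (ℝ × (ℕ → ℝ)) :=
  {w | (fun i => qq w (x.2 i)) ∈ CFset (x.1 + 1) ∧ ∀ j : Fin (m + 1), ∃ i, qq w j = qq w (x.2 i)}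

lemma Cc_closed (m : ℕ) (x : Idx m) : IsClosed (Cc m x) := by
  have : Cc m x = ((fun w => fun i => qq w (x.2 i)) ⁻¹' CFset (x.1 + 1)) ∩
      ⋂ j : Fin (m + 1), ⋃ i, {w | qq w j = qq w (x.2 i)} := by
    ext w; simp [Cc]
  rw [this]
  refine IsClosed.inter ?_ ?_
  · exact (CFset_closed _).preimage (continuous_pi fun i => qq_continuous _)
  · exact isClosed_iInter fun j => isClosed_iUnion_of_finite fun i =>
      isClosed_eq (qq_continuous _) (qq_continuous _)

noncomputable def RJ (m : ℕ) (x : Idx m) (w : Cc m x) : CF :=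
  Quot.mk CFrel ⟨x.1, ⟨fun i => qq w.1 (x.2 i), w.2.1⟩⟩

lemma RJ_cont (m : ℕ) (x : Idx m) : Continuous (RJ m x) := by
  have h1 : Continuous (Quot.mk CFrel) := continuous_quot_mk
  have h2 : Continuous fun t : CFn (x.1 + 1) => (⟨x.1, t⟩ : PreCF) :=
    @continuous_sigmaMk ℕ (fun n : ℕ => CFn (n + 1)) _ x.1
  refine h1.comp (h2.comp ?_)
  exact Continuous.subtype_mk (continuous_pi fun i =>
    (qq_continuous _).comp continuous_subtype_val) _

lemma RJ_pts (m : ℕ) (x : Idx m) (w : Cc m x) :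
    pts (RJ m x w) = (Finset.range (m + 1)).image (qq w.1) := by
  ext y
  unfold RJ
  rw [mem_pts]
  simp only [Finset.mem_image, Finset.mem_range]
  constructor
  · rintro ⟨i, rfl⟩
    exact ⟨x.2 i, (x.2 i).2, rfl⟩
  · rintro ⟨j, hj, rfl⟩
    obtain ⟨i, hi⟩ := w.2.2 ⟨j, hj⟩
    exact ⟨i, hi.symm⟩

lemma Cc_cover (m : ℕ) {w : ℝ × (ℕ → ℝ)} (hw : OKw m w) : ∃ x : Idx m, w ∈ Cc m x := by
  classical
  let J : Finset (Fin (m + 1)) := Finset.univ.filter fun j => ∀ i : ℕ, i < j → qq w i < qq w j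
  have h0 : (0 : Fin (m + 1)) ∈ J := by simp [J]
  have hJ : ∀ j ∈ J, ∀ i : ℕ, i < (j : ℕ) → qq w i < qq w j := by
    intro j hj; exact (Finset.mem_filter.1 hj).2
  have hpos : ∀ j ∈ J, ∀ i : ℕ, i + 1 = (j : ℕ) → 0 < w.2 i := by
    intro j hj i hi
    have h1 := hJ j hj i (by omega)
    rw [← hi] at h1
    unfold qq at h1
    rw [Finset.sum_range_succ] at h1
    by_contra hle
    rw [max_eq_left (not_lt.1 hle)] at h1
    linarith
  have hcard : 1 ≤ J.card := Finset.card_pos.2 ⟨0, h0⟩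
  have hcard2 : J.card ≤ m + 1 := by simpa using Finset.card_le_univ J
  obtain ⟨k, hk⟩ := Nat.exists_eq_add_of_le hcard
  have hk' : J.card = k + 1 := by omega
  let e := J.orderEmbOfFin hk'
  have he : ∀ i, e i ∈ J := fun i => J.orderEmbOfFin_mem hk' i
  refine ⟨⟨⟨k, by omega⟩, e⟩, ?_, ?_⟩
  · show (fun i : Fin (k + 1) => qq w (e i)) ∈ CFset (k + 1)
    rw [CFset_iff]
    refine ⟨fun a b hab => qq_mono w (e.monotone hab), fun a b hab => ?_⟩
    have hb := b.2
    let c : Fin (k + 1) := ⟨a + 1, by omega⟩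
    have h1 : e a < e c := e.strictMono (by rw [Fin.lt_def]; simp [c])
    have h2 : e c < e b := e.strictMono (by rw [Fin.lt_def]; simp [c]; omega)
    rw [Fin.lt_def] at h1 h2
    obtain ⟨y, hy⟩ := Nat.exists_eq_add_of_lt h1
    obtain ⟨z, hz⟩ := Nat.exists_eq_add_of_lt h2
    have hb' := (e b).2
    have p1 := hpos (e c) (he c) (e a + y) (by omega)
    have p2 := hpos (e b) (he b) (e c + z) (by omega)
    have := hw _ _ (show (e a : ℕ) + y < e c + z by omega) (by omega) p1 p2
    rw [← qq_sub w (by omega)] at this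
    have m1 := qq_mono w (show (e a : ℕ) ≤ e a + y by omega)
    rw [show (e c : ℕ) + z + 1 = e b by omega] at this
    linarith
  · intro j
    obtain ⟨i, hi, hmin⟩ : ∃ i : ℕ, qq w i = qq w j ∧ ∀ i' < i, qq w i' ≠ qq w j := by
      have hex : ∃ i : ℕ, qq w i = qq w j := ⟨j, rfl⟩
      exact ⟨Nat.find hex, Nat.find_spec hex, fun i' h => Nat.find_min hex h⟩
    have hij : i ≤ j := by
      by_contra hlt
      exact hmin j (by omega) rfl
    have him : i < m + 1 := by have := j.2; omega
    have hiJ : (⟨i, him⟩ : Fin (m + 1)) ∈ J := by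
      simp only [J, Finset.mem_filter, Finset.mem_univ, true_and]
      intro i' hi'
      refine lt_of_le_of_ne (qq_mono w hi'.le) ?_
      show qq w i' ≠ qq w i
      rw [hi]; exact hmin i' hi'
    have : (⟨i, him⟩ : Fin (m + 1)) ∈ Set.range e := by
      rw [Finset.range_orderEmbOfFin]; exact hiJ
    obtain ⟨x, hx⟩ := this
    refine ⟨x, ?_⟩
    show qq w j = qq w (e x)
    rw [hx, ← hi]

lemma R_exists (m : ℕ) : ∃ R : C(Wset m, CF),
    ∀ w, pts (R w) = (Finset.range (m + 1)).image (qq w.1) := by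
  have hx : ∀ w : Wset m, ∃ c : CF, pts c = (Finset.range (m + 1)).image (qq w.1) := by
    intro w
    obtain ⟨x, hx⟩ := Cc_cover m (Wset_OK w.2)
    exact ⟨RJ m x ⟨w.1, hx⟩, RJ_pts m x _⟩
  choose R hR using hx
  refine ⟨⟨R, ?_⟩, hR⟩
  refine (locallyFinite_of_finite (fun x : Idx m => (Subtype.val ⁻¹' Cc m x : Set (Wset m)))).continuous
    ?_ ?_ ?_
  · rw [Set.eq_univ_iff_forall]
    intro w
    obtain ⟨x, hx⟩ := Cc_cover m (Wset_OK w.2)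
    exact Set.mem_iUnion.2 ⟨x, hx⟩
  · intro x
    exact (Cc_closed m x).preimage continuous_subtype_val
  · intro x
    rw [continuousOn_iff_continuous_domRestrict]
    have : (Subtype.val ⁻¹' Cc m x : Set (Wset m)).domRestrict R =
        fun w => RJ m x ⟨w.1.1, w.2⟩ := by
      funext w
      apply pts_injective
      rw [RJ_pts]
      exact hR w.1
    rw [this]
    exact (RJ_cont m x).comp (Continuous.subtype_mk
      (continuous_subtype_val.comp continuous_subtype_val) _)

noncomputable def Cw (m : ℕ) (w : ℝ × (ℕ → ℝ)) : ℝ := 1 + ∑ l ∈ Finset.range m, |w.2 l|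

lemma Cw_cont (m : ℕ) : Continuous (Cw m) := by
  unfold Cw
  refine continuous_const.add (continuous_finsetSum _ fun l _ => ?_)
  exact ((continuous_apply l).comp continuous_snd).abs

lemma Cw_nonneg (m : ℕ) (w) : 0 ≤ Cw m w := by
  unfold Cw
  have : 0 ≤ ∑ l ∈ Finset.range m, |w.2 l| := Finset.sum_nonneg fun _ _ => abs_nonneg _
  linarith

lemma Cw_ge (m : ℕ) (w : ℝ × (ℕ → ℝ)) {l : ℕ} (hl : l < m) : 1 ≤ w.2 l + Cw m w := by
  unfold Cw
  have := Finset.single_le_sum (f := fun l => |w.2 l|) (fun _ _ => abs_nonneg _)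
    (Finset.mem_range.2 hl)
  have := neg_abs_le (w.2 l)
  linarith

lemma Wset_add {m : ℕ} {w : ℝ × (ℕ → ℝ)} (hw : w ∈ Wset m) {s : ℝ} (hs : 0 ≤ s) :
    ((w.1, fun l => w.2 l + s) : ℝ × (ℕ → ℝ)) ∈ Wset m := by
  intro s' hs'
  have := hw (s + s') (by linarith)
  simpa [add_assoc] using this

lemma Wset_ge {m : ℕ} {w : ℝ × (ℕ → ℝ)} (hw : ∀ l < m, 1 ≤ w.2 l) : w ∈ Wset m := by
  intro s hs a b hab hb _ _
  have h1 := Finset.single_le_sum (f := fun l => max 0 (w.2 l + s)) (s := Finset.Ico a (b + 1))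
    (fun _ _ => le_max_left _ _) (a := a) (Finset.mem_Ico.2 ⟨le_rfl, by omega⟩)
  have h2 := hw a (by omega)
  have h3 := le_max_right 0 (w.2 a + s)
  show 1 ≤ ∑ l ∈ Finset.Ico a (b + 1), max 0 (w.2 l + s)
  linarith

lemma Wset_contractible (m : ℕ) : ContractibleSpace (Wset m) := by
  rw [contractible_iff_id_nullhomotopic]
  have hb : ((0, fun _ => 1) : ℝ × (ℕ → ℝ)) ∈ Wset m := Wset_ge fun l _ => le_rfl
  refine ⟨⟨_, hb⟩, ?_⟩
  let g : C(Wset m, Wset m) := ⟨fun w => ⟨(w.1.1, fun l => w.1.2 l + Cw m w.1),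
    Wset_add w.2 (Cw_nonneg m _)⟩, by
      refine Continuous.subtype_mk (Continuous.prodMk (by fun_prop) (continuous_pi fun l => ?_)) _
      exact ((continuous_apply l).comp (continuous_snd.comp continuous_subtype_val)).add
        ((Cw_cont m).comp continuous_subtype_val)⟩
  have h1 : (ContinuousMap.id (Wset m)).Homotopic g := ⟨{
    toFun := fun p => ⟨(p.2.1.1, fun l => p.2.1.2 l + p.1 * Cw m p.2.1),
      Wset_add p.2.2 (mul_nonneg p.1.2.1 (Cw_nonneg m _))⟩
    continuous_toFun := by
      have hc : Continuous fun p : unitInterval × Wset m => p.2.1 :=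
        continuous_subtype_val.comp continuous_snd
      refine Continuous.subtype_mk (Continuous.prodMk (continuous_fst.comp hc)
        (continuous_pi fun l => ?_)) _
      exact ((continuous_apply l).comp (continuous_snd.comp hc)).add
        ((continuous_subtype_val.comp continuous_fst).mul ((Cw_cont m).comp hc))
    map_zero_left := fun w => by apply Subtype.ext; simp
    map_one_left := fun w => by apply Subtype.ext; simp [g] }⟩
  have h2 : g.Homotopic (ContinuousMap.const _ ⟨_, hb⟩) := ⟨{
    toFun := fun p => ⟨((1 - p.1) * p.2.1.1,
        fun l => (1 - p.1) * (p.2.1.2 l + Cw m p.2.1) + p.1), by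
      refine Wset_ge fun l hl => ?_
      have h1 := Cw_ge m p.2.1 hl
      have h2 := p.1.2.1
      have h3 := p.1.2.2
      show 1 ≤ (1 - (p.1 : ℝ)) * (p.2.1.2 l + Cw m p.2.1) + p.1
      nlinarith⟩
    continuous_toFun := by
      have hc : Continuous fun p : unitInterval × Wset m => p.2.1 :=
        continuous_subtype_val.comp continuous_snd
      have ht : Continuous fun p : unitInterval × Wset m => (p.1 : ℝ) :=
        continuous_subtype_val.comp continuous_fst
      refine Continuous.subtype_mk (Continuous.prodMk
        ((continuous_const.sub ht).mul (continuous_fst.comp hc)) (continuous_pi fun l => ?_)) _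
      exact ((continuous_const.sub ht).mul (((continuous_apply l).comp (continuous_snd.comp hc)).add
        ((Cw_cont m).comp hc))).add ht
    map_zero_left := fun w => by apply Subtype.ext; simp [g]
    map_one_left := fun w => by apply Subtype.ext; simp }⟩
  exact h1.trans h2

noncomputable def wpt (N : ℕ) (c : CF) (lam : ℝ ≃o ℝ) : ℝ × (ℕ → ℝ) :=
  (tau c 0, fun l => Gf (tau c) (lam (((l + 1 : ℕ) : ℤ) / 2 ^ N)))

lemma wpt_mem (m : ℕ) {N : ℕ} (c : CF) {lam : ℝ ≃o ℝ} (h : SD N lam) : wpt N c lam ∈ Wset m := by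
  intro s hs a b hab hb ha0 hb0
  have hcfg := (tau_spec c).cfg
  set G : ℕ → ℝ := fun l => Gf (tau c) (lam (((l + 1 : ℕ) : ℤ) / 2 ^ N)) + s with hG
  show 1 ≤ ∑ l ∈ Finset.Ico a (b + 1), max 0 (G l)
  have ix : ∀ z : ℤ, ((a + 1 : ℕ) : ℤ) ≤ z → z ≤ ((b + 1 : ℕ) : ℤ) →
      ∃ l : ℕ, l ∈ Finset.Ico a (b + 1) ∧ z = ((l + 1 : ℕ) : ℤ) := by
    intro z h1 h2
    refine ⟨(z - 1).toNat, Finset.mem_Ico.2 ⟨by omega, by omega⟩, by omega⟩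
  rcases SD_valid hcfg h (s := s) (a := ((a + 1 : ℕ) : ℤ)) (b := ((b + 1 : ℕ) : ℤ)) (by omega)
    ha0 hb0 hs with ⟨z, z1, z2, hz⟩ | ⟨z, z', z1, z2, z3, hz⟩
  · obtain ⟨l, hl, rfl⟩ := ix z z1 z2
    have h1 := Finset.single_le_sum (f := fun l => max 0 (G l)) (fun _ _ => le_max_left _ _) hl
    have h2 := le_max_right 0 (G l)
    have h3 : 1 ≤ G l := hz
    linarith
  · obtain ⟨l, hl, rfl⟩ := ix z z1 (by omega)
    obtain ⟨l', hl', rfl⟩ := ix z' (by omega) z3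
    have hne : l ≠ l' := by omega
    have h1 := Finset.sum_le_sum_of_subset_of_nonneg (f := fun l => max 0 (G l))
      (s := {l, l'}) (t := Finset.Ico a (b + 1)) (by
        intro y hy
        simp only [Finset.mem_insert, Finset.mem_singleton] at hy
        rcases hy with rfl | rfl
        · exact hl
        · exact hl') (fun _ _ _ => le_max_left _ _)
    rw [Finset.sum_pair hne] at h1
    have h2 := le_max_right 0 (G l)
    have h2' := le_max_right 0 (G l')
    have h3 : 1 ≤ G l + G l' := hz
    linarith

lemma wpt_qq {N : ℕ} (c : CF) {lam : ℝ ≃o ℝ} (h : SD N lam) (h0 : lam 0 = 0) (j : ℕ) :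
    qq (wpt N c lam) j = tau c ⌊lam (((j : ℕ) : ℤ) / 2 ^ N)⌋ := by
  obtain ⟨hi, hd, -⟩ := SD_between h
  have hcfg := (tau_spec c).cfg
  have hp : (0:ℝ) < 2 ^ N := by positivity
  have cmp : ∀ x y : ℤ, lam (x / 2 ^ N) < lam (y / 2 ^ N) ↔ x < y := by
    intro x y
    rw [lam.lt_iff_lt, div_lt_div_iff_of_pos_right hp]; exact_mod_cast Iff.rfl
  have cmp' : ∀ x y : ℤ, lam (x / 2 ^ N) ≤ lam (y / 2 ^ N) ↔ x ≤ y := by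
    intro x y
    rw [lam.le_iff_le, div_le_div_iff_of_pos_right hp]; exact_mod_cast Iff.rfl
  induction j with
  | zero => simp [qq, wpt, h0]
  | succ j ih =>
    have : qq (wpt N c lam) (j + 1) = qq (wpt N c lam) j +
        max 0 (Gf (tau c) (lam (((j + 1 : ℕ) : ℤ) / 2 ^ N))) := by
      unfold qq; rw [Finset.sum_range_succ, add_assoc]; rfl
    rw [this, ih]
    have hlt := (cmp (j : ℤ) ((j + 1 : ℕ) : ℤ)).2 (by omega)
    obtain ⟨k, dv⟩ := hd _ ⟨((j + 1 : ℕ) : ℤ), rfl⟩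
    obtain ⟨jz, hjz⟩ := hi ⌊lam (((j + 1 : ℕ) : ℤ) / 2 ^ N)⌋
    obtain ⟨jy, hjy⟩ := hi (⌊lam (((j + 1 : ℕ) : ℤ) / 2 ^ N)⌋ - 1)
    have l1 := cmp (j : ℤ) jz
    have l2 := cmp jz ((j + 1 : ℕ) : ℤ)
    have l3 := cmp jy ((j + 1 : ℕ) : ℤ)
    have l4 := cmp' jy (j : ℤ)
    rw [hjz] at l1 l2
    rw [hjy] at l3 l4
    generalize lam (((j + 1 : ℕ) : ℤ) / 2 ^ N) = v' at *
    generalize lam ((j : ℤ) / 2 ^ N) = v at *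
    by_cases iv : (⌊v'⌋ : ℝ) = v'
    · have e : ⌊v⌋ = ⌊v'⌋ - 1 := by
        rw [Int.floor_eq_iff]
        constructor
        · apply l4.2
          have : jy < ((j + 1 : ℕ) : ℤ) := l3.1 (by push_cast; linarith)
          omega
        · push_cast; linarith
      rw [e]
      have g : Gf (tau c) v' = tau c ⌊v'⌋ - tau c (⌊v'⌋ - 1) := by
        conv_lhs => rw [← iv]
        exact Gf_int _ _
      have : tau c (⌊v'⌋ - 1) ≤ tau c ⌊v'⌋ := hcfg.1.monotone (by omega)
      rw [g, max_eq_right (by linarith)]; ring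
    · have e : ⌊v⌋ = ⌊v'⌋ := by
        apply le_antisymm (Int.floor_mono hlt.le)
        rw [Int.le_floor]
        by_contra hlt'
        have a1 := l1.1 (not_le.1 hlt')
        have a2 := l2.1 (lt_of_le_of_ne (Int.floor_le _) iv)
        omega
      have := dep_pos dv iv
      have h1 : (1:ℝ) ≤ dep v' := by exact_mod_cast this
      have h2 : rr (tau c) ⌊v'⌋ ≤ 1 := min_le_left _ _
      rw [Gf_nonint _ iv, max_eq_left (by linarith), e, add_zero]

lemma wpt_image {N : ℕ} (c : CF) {lam : ℝ ≃o ℝ} (h : SD N lam) (h0 : lam 0 = 0) {n0 : ℕ}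
    (hn : lam n0 = num c) {m : ℕ} (hm : m + 1 = n0 * 2 ^ N) :
    (Finset.range (m + 1)).image (qq (wpt N c lam)) = pts c := by
  obtain ⟨hi, hd, -⟩ := SD_between h
  have hp : (0:ℝ) < 2 ^ N := by positivity
  ext x
  rw [(tau_spec c).mem]
  simp only [Finset.mem_image, Finset.mem_range, wpt_qq c h h0]
  constructor
  · rintro ⟨j, hj, rfl⟩
    refine ⟨_, ?_, ?_, rfl⟩
    · rw [Int.floor_nonneg, ← h0, lam.le_iff_le]; positivity
    · rw [Int.floor_lt, ← hn, lam.lt_iff_lt, div_lt_iff₀ hp]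
      rw [hm] at hj
      exact_mod_cast hj
  · rintro ⟨i, hi0, hin, rfl⟩
    obtain ⟨z, hz⟩ := hi i
    have z0 : 0 ≤ z := by
      have : lam 0 ≤ lam (z / 2 ^ N) := by rw [h0, hz]; exact_mod_cast hi0
      rw [lam.le_iff_le, le_div_iff₀ hp] at this
      simp at this; exact this
    have z1 : z < n0 * 2 ^ N := by
      have : lam (z / 2 ^ N) < lam n0 := by rw [hn, hz]; exact_mod_cast hin
      rw [lam.lt_iff_lt, div_lt_iff₀ hp] at this
      exact_mod_cast this
    obtain ⟨j, rfl⟩ := Int.eq_ofNat_of_zero_le z0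
    refine ⟨j, ?_, ?_⟩
    · rw [hm]; exact_mod_cast z1
    · rw [hz]; simp

lemma wpt_close {N : ℕ} {c d : CF} {lam : ℝ ≃o ℝ} (h : SD N lam) {r : ℝ} (h0 : 0 < r)
    (hr : r ≤ rad c) (hn : Near r (pts c) (pts d)) (l : ℕ) :
    |(wpt N d (th c d * lam)).1 - (wpt N c lam).1| < r ∧
    |(wpt N d (th c d * lam)).2 l - (wpt N c lam).2 l| ≤ 4 * r := by
  refine ⟨(near_ends (tau_spec c) (tau_spec d) hn).1, ?_⟩
  obtain ⟨K, hK, mK, -, -, tK, sK⟩ := th_near h0 hr hn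
  obtain ⟨-, hd, -⟩ := SD_between h
  obtain ⟨k, dv⟩ := hd _ ⟨((l + 1 : ℕ) : ℤ), rfl⟩
  rw [tK]
  exact Gf_close (tau_spec d).cfg (by linarith [(rad_spec c).2.1]) mK dv

lemma plFun_int (K : ℤ → ℤ) (i : ℤ) : plFun K i = K i := by
  rw [plFun_eq K i _ le_rfl (by linarith)]; simp

def Good (n0 : ℕ) (c : CF) (lam : ℝ ≃o ℝ) : Prop :=
  (∃ N, SD N lam) ∧ lam 0 = 0 ∧ lam n0 = num c

lemma Good_iff {n0 : ℕ} {c d : CF} {lam : ℝ ≃o ℝ} (hn : Near (rad c) (pts c) (pts d)) :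
    Good n0 d (th c d * lam) ↔ Good n0 c lam := by
  obtain ⟨K, hK, mK, k0, k1, tK, sK⟩ := th_near (rad_spec c).1 le_rfl hn
  rw [tK]
  have e0 : plFun K 0 = 0 := by
    have := plFun_int K 0
    rw [k0] at this
    simpa using this
  have e1 : plFun K (num c) = num d := by rw [plFun_int, k1]
  have inj := (plFun_strictMono hK).injective
  unfold Good
  constructor
  · rintro ⟨⟨N, hN⟩, h0, h1⟩
    refine ⟨⟨_, SD_pl' hK sK hN⟩, inj ?_, inj ?_⟩
    · rw [e0]; exact h0
    · rw [e1]; exact h1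
  · rintro ⟨⟨N, hN⟩, h0, h1⟩
    refine ⟨⟨_, SD_pl hK sK hN⟩, ?_, ?_⟩
    · show plFun K (lam 0) = 0
      rw [h0, e0]
    · show plFun K (lam n0) = _
      rw [h1, e1]

lemma SD_near {N : ℕ} {c d : CF} {lam : ℝ ≃o ℝ} (hn : Near (rad c) (pts c) (pts d))
    (h : SD N lam) : SD (N + 1) (th c d * lam) := by
  obtain ⟨K, hK, mK, k0, k1, tK, sK⟩ := th_near (rad_spec c).1 le_rfl hn
  rw [tK]
  exact SD_pl hK sK h

/-- The lift along a cube. -/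
lemma cube_lift {k : ℕ} (f : C(Fin k → I, CF)) : ∃ l : (Fin k → I) → (ℝ ≃o ℝ),
    l (fun _ => 0) = 1 ∧ (∀ a, ∀ᶠ b in 𝓝 a, l b = th (f a) (f b) * l a) ∧
    ∀ n0 : ℕ, (n0 : ℤ) = num (f fun _ => 0) → ∀ a, Good n0 (f a) (l a) := by
  let pr : (Fin k → ℝ) → (Fin k → I) := fun a i => Set.projIcc (0:ℝ) 1 zero_le_one (a i)
  have hpr : Continuous pr := continuous_pi fun i => continuous_projIcc.comp (continuous_apply i)
  let ι : (Fin k → I) → (Fin k → ℝ) := fun a i => a i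
  have hι : Continuous ι := continuous_pi fun i => continuous_subtype_val.comp (continuous_apply i)
  have hpi : ∀ a, pr (ι a) = a := fun a => funext fun i => Set.projIcc_val zero_le_one (a i)
  have hf' : Continuous (f ∘ pr) := f.continuous.comp hpr
  obtain ⟨l, l0, hl⟩ := lift_cocycle
    (fun a : Fin k → ℝ => (f ∘ pr) ⁻¹' {c | Near (rad ((f ∘ pr) a)) (pts ((f ∘ pr) a)) (pts c)})
    (fun a => (isOpen_near _ _).preimage hf') (fun a => near_self (rad_spec _).1 _)
    (fun a b => th ((f ∘ pr) a) ((f ∘ pr) b)) (fun a => th_self _)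
    (by
      intro a b hb
      filter_upwards [near_nhds hf' b (lt_min (rad_spec ((f ∘ pr) a)).1 (rad_spec ((f ∘ pr) b)).1)]
        with c hc hca
      exact th_coc _ _ _ hb hc hca) (ι fun _ => 0)
  refine ⟨l ∘ ι, l0, ?_, ?_⟩
  · intro a
    have := hι.continuousAt.eventually (hl (ι a))
    filter_upwards [this] with b hb
    simp only [Function.comp] at hb ⊢
    rw [hb, hpi, hpi]
  · intro n0 hn0 a
    have hloc : IsLocallyConstant fun a => Good n0 ((f ∘ pr) a) (l a) := by
      rw [IsLocallyConstant.iff_eventually_eq]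
      intro a
      filter_upwards [hl a, near_nhds hf' a (rad_spec _).1] with b hb hn
      rw [hb]
      exact propext (Good_iff hn)
    have h1 := hloc.apply_eq_of_preconnectedSpace (ι a) (ι fun _ => 0)
    simp only [Function.comp, hpi] at h1
    show Good n0 (f a) (l (ι a))
    rw [h1, l0]
    refine ⟨⟨0, SD_one⟩, rfl, ?_⟩
    show (n0 : ℝ) = _
    rw [← hn0]; simp

lemma path_const {k : ℕ} (f : C(Fin k → I, CF)) (x : CF) {l : (Fin k → I) → (ℝ ≃o ℝ)}
    (hl : ∀ a, ∀ᶠ b in 𝓝 a, l b = th (f a) (f b) * l a) (γ : C(I, Fin k → I))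
    (hγ : ∀ s, f (γ s) = x) : l (γ 1) = l (γ 0) := by
  have hloc : IsLocallyConstant fun s => l (γ s) := by
    rw [IsLocallyConstant.iff_eventually_eq]
    intro s
    filter_upwards [γ.continuous.continuousAt.eventually (hl (γ s))] with t ht
    rw [ht, hγ, hγ, th_self, one_mul]
  exact hloc.apply_eq_of_preconnectedSpace 1 0

lemma boundary_const {k : ℕ} (hk : 2 ≤ k) (f : C(Fin k → I, CF)) (x : CF)
    {l : (Fin k → I) → (ℝ ≃o ℝ)} (l0 : l (fun _ => 0) = 1)
    (hl : ∀ a, ∀ᶠ b in 𝓝 a, l b = th (f a) (f b) * l a)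
    (hf : ∀ y ∈ Cube.boundary (Fin k), f y = x) (y : Fin k → I)
    (hy : y ∈ Cube.boundary (Fin k)) : l y = 1 := by
  classical
  obtain ⟨i0, hi0⟩ := hy
  obtain ⟨i1, hi1⟩ : ∃ i1 : Fin k, i1 ≠ i0 := by
    by_cases h : (i0 : ℕ) = 0
    · exact ⟨⟨1, by omega⟩, fun hh => by rw [← hh] at h; simp at h⟩
    · exact ⟨⟨0, by omega⟩, fun hh => by rw [← hh] at h; simp at h⟩
  let γ1 : C(I, Fin k → I) := ⟨fun s j => if j = i0 then y j else s * y j,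
    continuous_pi fun j => by
      by_cases hj : j = i0
      · simp only [hj, if_true]; exact continuous_const
      · simp only [hj, if_false]; exact continuous_id.mul continuous_const⟩
  let γ2 : C(I, Fin k → I) := ⟨fun s j => if j = i0 then s * y j else 0,
    continuous_pi fun j => by
      by_cases hj : j = i0
      · simp only [hj, if_true]; exact continuous_id.mul continuous_const
      · simp only [hj, if_false]; exact continuous_const⟩
  have h1 := path_const f x hl γ1 (fun s => hf _ ⟨i0, by simpa [γ1] using hi0⟩)
  have h2 := path_const f x hl γ2 (fun s => hf _ ⟨i1, by left; simp [γ2, hi1]⟩)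
  have e1 : γ1 1 = y := by funext j; simp [γ1]
  have e2 : γ1 0 = γ2 1 := by funext j; simp [γ1, γ2]
  have e3 : γ2 0 = fun _ => 0 := by funext j; simp [γ2]
  rw [e1, e2, h2, e3, l0] at h1
  exact h1

lemma uniform_SD {k : ℕ} (f : C(Fin k → I, CF)) {l : (Fin k → I) → (ℝ ≃o ℝ)}
    (hl : ∀ a, ∀ᶠ b in 𝓝 a, l b = th (f a) (f b) * l a) (h : ∀ a, ∃ N, SD N (l a)) :
    ∃ N, ∀ a, SD N (l a) := by
  have := (isCompact_univ (X := Fin k → I)).induction_on (p := fun s => ∃ N, ∀ a ∈ s, SD N (l a))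
    ⟨0, fun a ha => ha.elim⟩ (fun s t hst ⟨N, hN⟩ => ⟨N, fun a ha => hN a (hst ha)⟩)
    (fun s t ⟨N, hN⟩ ⟨N', hN'⟩ => ⟨max N N', fun a ha => ha.elim
      (fun ha => (hN a ha).mono (le_max_left _ _)) (fun ha => (hN' a ha).mono (le_max_right _ _))⟩)
    (by
      intro a _
      obtain ⟨N, hN⟩ := h a
      refine ⟨{b | SD (N + 1) (l b)}, ?_, N + 1, fun b hb => hb⟩
      apply mem_nhdsWithin_of_mem_nhds
      filter_upwards [hl a, near_nhds f.continuous a (rad_spec _).1] with b hb hn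
      show SD (N + 1) (l b)
      rw [hb]
      exact SD_near hn hN)
  obtain ⟨N, hN⟩ := this
  exact ⟨N, fun a => hN a trivial⟩

lemma wpt_cont {k : ℕ} (f : C(Fin k → I, CF)) {l : (Fin k → I) → (ℝ ≃o ℝ)}
    (hl : ∀ a, ∀ᶠ b in 𝓝 a, l b = th (f a) (f b) * l a) {N : ℕ} (h : ∀ a, SD N (l a)) :
    Continuous fun a => wpt N (f a) (l a) := by
  have key : ∀ a, ∀ ε > 0, ∀ j, ∀ᶠ b in 𝓝 a,
      |(wpt N (f b) (l b)).1 - (wpt N (f a) (l a)).1| < ε ∧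
      |(wpt N (f b) (l b)).2 j - (wpt N (f a) (l a)).2 j| < ε := by
    intro a ε hε j
    have hr : 0 < min (rad (f a)) (ε / 8) := lt_min (rad_spec _).1 (by linarith)
    filter_upwards [hl a, near_nhds f.continuous a hr] with b hb hn
    obtain ⟨h1, h2⟩ := wpt_close (h a) hr (min_le_left _ _) hn j
    rw [hb]
    have := min_le_right (rad (f a)) (ε / 8)
    exact ⟨by linarith, by linarith⟩
  refine Continuous.prodMk ?_ (continuous_pi fun j => ?_)
  · rw [continuous_iff_continuousAt]
    intro a
    refine Metric.tendsto_nhds.2 fun ε hε => ?_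
    filter_upwards [key a ε hε 0] with b hb
    rw [Real.dist_eq]; exact hb.1
  · rw [continuous_iff_continuousAt]
    intro a
    refine Metric.tendsto_nhds.2 fun ε hε => ?_
    filter_upwards [key a ε hε j] with b hb
    rw [Real.dist_eq]; exact hb.2

lemma loop_null {k : ℕ} (hk : 2 ≤ k) (f : C(Fin k → I, CF)) (x : CF)
    (hf : ∀ y ∈ Cube.boundary (Fin k), f y = x) :
    f.HomotopicRel (ContinuousMap.const _ x) (Cube.boundary (Fin k)) := by
  obtain ⟨l, l0, hl, hG⟩ := cube_lift f
  obtain ⟨n0, hn0⟩ := Int.eq_ofNat_of_zero_le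
    (show 0 ≤ num (f fun _ => 0) by have := (tau_spec (f fun _ => 0)).pos; omega)
  have hG' := hG n0 hn0.symm
  obtain ⟨N, hN⟩ := uniform_SD f hl (fun a => (hG' a).1)
  have hn1 : 1 ≤ n0 := by have := (tau_spec (f fun _ => 0)).pos; omega
  obtain ⟨m, hm⟩ : ∃ m, m + 1 = n0 * 2 ^ N :=
    ⟨n0 * 2 ^ N - 1, Nat.sub_add_cancel (Nat.mul_pos hn1 (by positivity))⟩
  obtain ⟨R, hR⟩ := R_exists m
  have hW := Wset_contractible m
  let F : C(Fin k → I, Wset m) := ⟨fun a => ⟨wpt N (f a) (l a), wpt_mem m _ (hN a)⟩,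
    Continuous.subtype_mk (wpt_cont f hl hN) _⟩
  have hRF : R.comp F = f := by
    ext1 a
    apply pts_injective
    show pts (R (F a)) = _
    rw [hR]
    exact wpt_image (f a) (hN a) (hG' a).2.1 (hG' a).2.2 hm
  have hb0 : (fun _ => 0 : Fin k → I) ∈ Cube.boundary (Fin k) := ⟨⟨0, by omega⟩, Or.inl rfl⟩
  have hFb : ∀ y ∈ Cube.boundary (Fin k), F y = F (fun _ => 0) := by
    intro y hy
    apply Subtype.ext
    show wpt N (f y) (l y) = wpt N (f fun _ => 0) (l fun _ => 0)
    rw [hf y hy, hf _ hb0, boundary_const hk f x l0 hl hf y hy, l0]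
  have := ContinuousMap.HomotopicRel.comp_continuousMap (genLoop_null F (F fun _ => 0) hFb) R
  rw [hRF] at this
  have e : R.comp (ContinuousMap.const (Fin k → I) (F fun _ => 0)) = ContinuousMap.const _ x := by
    ext1 a
    show R (F fun _ => 0) = x
    rw [← hf _ hb0, ← hRF]; rfl
  rwa [e] at this

/-- Belk's space `CF` is aspherical: for every `k ≥ 2` and every basepoint,
`π_k(CF)` is trivial. -/
theorem CF_aspherical :
    ∀ k : ℕ, 2 ≤ k → ∀ x : CF, Subsingleton (HomotopyGroup (Fin k) CF x) := by
  intro k hk x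
  have key : ∀ f : GenLoop (Fin k) CF x, GenLoop.Homotopic f GenLoop.const := fun f =>
    loop_null hk f.1 x f.2
  refine ⟨fun a b => ?_⟩
  induction a using Quotient.inductionOn with
  | h f =>
  induction b using Quotient.inductionOn with
  | h g => exact Quotient.sound ((key f).trans (key g).symm)
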